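/- arXiv:2006.07238 — 9 statements merged into one kernel-verified Lean document; each statement's English description precedes it below -/
import Mathlib

section
/- Assume that ∑_{n≥1}(1-p_n) = +∞ and that for every δ > 0 and every k ∈ ℕ there exists n such that p_n, p_{n+1}, …, p_{n+k} all lie in [1-δ, 1]. Then there exists a sequence (a_j) of positive integers with a_j → +∞ such that ∫ cos(2π a_j t) dν(t) → 1; equivalently, the unitary multiplication operators f(t) ↦ e^{2πi a_j t} f(t) on L²([-1/2,1/2], ν; ℂ) converge strongly to the identity. -/
open MeasureTheory Filter
open scoped ENNReal

noncomputable section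

/-- The `n`-th factor measure `((1-pₙ)/2)·δ₋₁ + pₙ·δ₀ + ((1-pₙ)/2)·δ₁` on `ℝ`. -/
def cantorFactor (p : ℕ → ℝ) (n : ℕ) : Measure ℝ :=
  ENNReal.ofReal ((1 - p n) / 2) • Measure.dirac (-1 : ℝ)
    + ENNReal.ofReal (p n) • Measure.dirac (0 : ℝ)
    + ENNReal.ofReal ((1 - p n) / 2) • Measure.dirac (1 : ℝ)

/-- `θ(x) = ∑_{n=1}^∞ 3⁻ⁿ xₙ`. -/
def cantorCoord (x : ℕ → ℝ) : ℝ := ∑' n : ℕ, ((3 : ℝ)⁻¹) ^ (n + 1) * x (n + 1)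

/-- `ζ` is the product probability measure on `{-1,0,1}^{ℕ≥1}` (viewed inside `ℕ → ℝ`)
whose `n`-th factor (`n ≥ 1`) is `cantorFactor p n`; we characterize it by its values
on cylinder sets over coordinates `n ≥ 1`. -/
def IsCantorProductMeasure (p : ℕ → ℝ) (ζ : Measure (ℕ → ℝ)) : Prop :=
  IsProbabilityMeasure ζ ∧
    ∀ s : Finset ℕ, (∀ n ∈ s, 1 ≤ n) →
      ∀ B : ℕ → Set ℝ, (∀ n, MeasurableSet (B n)) →
        ζ {x | ∀ n ∈ s, x n ∈ B n} = ∏ n ∈ s, cantorFactor p n (B n)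

/-- `r_m = 3^{2m} p₁ ⋯ p_{m-1} (1 - p_m)`. -/
def cantorR (p : ℕ → ℝ) (m : ℕ) : ℝ :=
  (3 : ℝ) ^ (2 * m) * (∏ k ∈ Finset.Ico 1 m, p k) * (1 - p m)

end

namespace IsCantorProductMeasure

variable {p : ℕ → ℝ} {ζ : Measure (ℕ → ℝ)}

/-- Almost every point has all its coordinates of index `n ≥ 1` in `{-1, 0, 1}`. -/
theorem ae_mem (hζ : IsCantorProductMeasure p ζ) (hp : ∀ n, 1 ≤ n → 0 ≤ p n ∧ p n ≤ 1) :
    ∀ᵐ x ∂ζ, ∀ n, 1 ≤ n → x n = -1 ∨ x n = 0 ∨ x n = 1 := by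
  have := hζ.1
  rw [ae_all_iff]
  intro n
  rw [ae_all_iff]
  intro hn
  obtain ⟨h0, h1⟩ := hp n hn
  have hB : MeasurableSet ({-1, 0, 1} : Set ℝ) := by measurability
  have key := hζ.2 {n} (by simpa using hn) (fun _ => {-1, 0, 1}) (fun _ => hB)
  have hfac : cantorFactor p n {-1, 0, 1} = 1 := by
    simp only [cantorFactor, Measure.add_apply, Measure.smul_apply, Measure.dirac_apply' _ hB]
    simp only [Set.mem_insert_iff, Set.mem_singleton_iff, true_or, or_true, Set.indicator_of_mem,
      Pi.one_apply, smul_eq_mul, mul_one]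
    rw [← ENNReal.ofReal_add (by linarith) h0, ← ENNReal.ofReal_add (by linarith) (by linarith)]
    rw [← ENNReal.ofReal_one]
    congr 1
    ring
  simp only [Finset.mem_singleton, forall_eq, Finset.prod_singleton, hfac] at key
  have hm : MeasurableSet {x : ℕ → ℝ | x n ∈ ({-1, 0, 1} : Set ℝ)} := measurable_pi_apply n hB
  have hae : {x : ℕ → ℝ | x n ∈ ({-1, 0, 1} : Set ℝ)} ∈ ae ζ :=
    (mem_ae_iff_prob_eq_one hm).2 key
  filter_upwards [hae] with x hx
  simpa using hx

/-- The probability that finitely many coordinates all vanish. -/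
theorem measure_forall_eq_zero (hζ : IsCantorProductMeasure p ζ) (s : Finset ℕ)
    (hs : ∀ n ∈ s, 1 ≤ n) :
    ζ {x | ∀ n ∈ s, x n = 0} = ∏ n ∈ s, ENNReal.ofReal (p n) := by
  have key := hζ.2 s hs (fun _ => {0}) (fun _ => measurableSet_singleton 0)
  simp only [Set.mem_singleton_iff] at key
  rw [key]
  refine Finset.prod_congr rfl fun n _ => ?_
  simp [cantorFactor, Measure.dirac_apply' _ (measurableSet_singleton (0 : ℝ))]

end IsCantorProductMeasure

theorem norm_cantorCoord_term_le {x : ℕ → ℝ} (hx : ∀ n, 1 ≤ n → x n = -1 ∨ x n = 0 ∨ x n = 1)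
    (n : ℕ) : ‖((3 : ℝ)⁻¹) ^ (n + 1) * x (n + 1)‖ ≤ ((3 : ℝ)⁻¹) ^ (n + 1) := by
  rw [norm_mul, Real.norm_of_nonneg (by positivity)]
  have : ‖x (n + 1)‖ ≤ 1 := by
    rcases hx (n + 1) (by omega) with h | h | h <;> simp [h]
  exact mul_le_of_le_one_right (by positivity) this

theorem summable_inv_three_pow_succ : Summable fun n : ℕ => ((3 : ℝ)⁻¹) ^ (n + 1) :=
  (summable_nat_add_iff 1).2 (summable_geometric_of_lt_one (by norm_num) (by norm_num))

theorem summable_cantorCoord {x : ℕ → ℝ} (hx : ∀ n, 1 ≤ n → x n = -1 ∨ x n = 0 ∨ x n = 1) :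
    Summable fun n : ℕ => ((3 : ℝ)⁻¹) ^ (n + 1) * x (n + 1) :=
  Summable.of_norm_bounded summable_inv_three_pow_succ (norm_cantorCoord_term_le hx)

theorem IsCantorProductMeasure.aemeasurable_cantorCoord {p : ℕ → ℝ} {ζ : Measure (ℕ → ℝ)}
    (hζ : IsCantorProductMeasure p ζ) (hp : ∀ n, 1 ≤ n → 0 ≤ p n ∧ p n ≤ 1) :
    AEMeasurable cantorCoord ζ := by
  refine aemeasurable_of_tendsto_metrizable_ae atTop
    (f := fun N x => ∑ n ∈ Finset.range N, ((3 : ℝ)⁻¹) ^ (n + 1) * x (n + 1))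
    (fun N => (Finset.measurable_fun_sum _ fun n _ =>
      (measurable_pi_apply (n + 1)).const_mul _).aemeasurable) ?_
  filter_upwards [hζ.ae_mem hp] with x hx
  exact (summable_cantorCoord hx).hasSum.tendsto_sum_nat

/-- If the digits of index `m + 1, …, m + j` vanish, then `3 ^ m * θ(x)` is within `3 ^ (-j)` of
an integer. -/
theorem exists_int_abs_sub_le {x : ℕ → ℝ} (hx : ∀ n, 1 ≤ n → x n = -1 ∨ x n = 0 ∨ x n = 1)
    {m j : ℕ} (h0 : ∀ n ∈ Finset.Icc (m + 1) (m + j), x n = 0) :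
    ∃ z : ℤ, |3 ^ m * cantorCoord x - z| ≤ ((3 : ℝ)⁻¹) ^ j := by
  have hint : ∀ n ∈ Finset.range (m + j),
      3 ^ m * (((3 : ℝ)⁻¹) ^ (n + 1) * x (n + 1)) ∈ (Int.castRingHom ℝ).range := by
    intro n hn
    rw [Finset.mem_range] at hn
    by_cases hnm : n < m
    · have hpow : (3 : ℝ) ^ m * (3⁻¹) ^ (n + 1) = 3 ^ (m - (n + 1)) := by
        rw [inv_pow, ← div_eq_mul_inv, pow_sub₀ _ (by norm_num) (by omega), div_eq_mul_inv]
      rw [← mul_assoc, hpow]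
      have h3 : (3 : ℝ) ∈ (Int.castRingHom ℝ).range := ⟨3, by simp⟩
      refine mul_mem (pow_mem h3 _) ?_
      rcases hx (n + 1) (by omega) with h | h | h <;> rw [h]
      · exact neg_mem (one_mem _)
      · exact zero_mem _
      · exact one_mem _
    · rw [h0 (n + 1) (by rw [Finset.mem_Icc]; omega)]
      simp
  obtain ⟨z, hz⟩ := sum_mem hint
  refine ⟨z, ?_⟩
  have hsplit := (summable_cantorCoord hx).sum_add_tsum_nat_add (m + j)
  have hgeom : HasSum (fun i : ℕ => ((3 : ℝ)⁻¹) ^ (i + (m + j) + 1))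
      ((1 - 3⁻¹)⁻¹ * 3⁻¹ ^ (m + j + 1)) := by
    simp only [add_assoc _ (m + j) 1, pow_add _ _ (m + j + 1)]
    exact (hasSum_geometric_of_lt_one (by norm_num) (by norm_num)).mul_right _
  have htail := tsum_of_norm_bounded hgeom fun i => norm_cantorCoord_term_le hx (i + (m + j))
  have heq : 3 ^ m * cantorCoord x - z = 3 ^ m *
      ∑' i : ℕ, ((3 : ℝ)⁻¹) ^ (i + (m + j) + 1) * x (i + (m + j) + 1) := by
    rw [← Finset.mul_sum] at hz
    simp only [eq_intCast] at hz
    rw [hz, cantorCoord, ← hsplit]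
    ring
  rw [heq, abs_mul, abs_of_pos (by positivity)]
  calc _ ≤ (3 : ℝ) ^ m * ((1 - 3⁻¹)⁻¹ * 3⁻¹ ^ (m + j + 1)) := by
        gcongr
        exact htail
    _ = ((3 : ℝ) ^ m * 3⁻¹ ^ m) * (3⁻¹ ^ j * 2⁻¹) := by
        rw [pow_succ, pow_add]
        norm_num
        ring
    _ = 3⁻¹ ^ j * 2⁻¹ := by
        rw [← mul_pow]
        norm_num
    _ ≤ 3⁻¹ ^ j := mul_le_of_le_one_right (by positivity) (by norm_num)

theorem one_sub_le_cos_two_pi_mul {u r : ℝ} (z : ℤ) (h : |u - z| ≤ r) :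
    1 - (2 * Real.pi * r) ^ 2 / 2 ≤ Real.cos (2 * Real.pi * u) := by
  have hcos : Real.cos (2 * Real.pi * u) = Real.cos (2 * Real.pi * (u - z)) := by
    rw [← Real.cos_sub_int_mul_two_pi (2 * Real.pi * u) z]
    congr 1
    ring
  have hsq : (u - z) ^ 2 ≤ r ^ 2 := sq_le_sq' (by linarith [neg_le_of_abs_le h]) (le_of_abs_le h)
  rw [hcos]
  refine le_trans ?_ (Real.one_sub_sq_div_two_le_cos)
  rw [mul_pow, mul_pow _ (u - z)]
  gcongr

/-- Lower bound for the integral of a function that is at least `-1`, and at least `c` on `G`. -/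
theorem le_integral_of_ae_le_on {Ω : Type*} [MeasurableSpace Ω] {μ : Measure Ω}
    [IsProbabilityMeasure μ] {f : Ω → ℝ} (hf : Integrable f μ) (hf1 : ∀ x, -1 ≤ f x)
    {G : Set Ω} (hG : MeasurableSet G) {c : ℝ} (hc : ∀ᵐ x ∂μ, x ∈ G → c ≤ f x) :
    μ.real G * (1 + c) - 1 ≤ ∫ x, f x ∂μ := by
  have hi : Integrable (G.indicator fun _ => 1 + c) μ := (integrable_const _).indicator hG
  have hint : ∫ x, (G.indicator (fun _ => 1 + c) x - 1) ∂μ = μ.real G * (1 + c) - 1 := by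
    rw [integral_sub hi (integrable_const _), integral_indicator_const _ hG]
    simp
  rw [← hint]
  refine integral_mono_ae (hi.sub (integrable_const _)) hf ?_
  filter_upwards [hc] with x hx
  by_cases hxG : x ∈ G
  · simpa [hxG] using hx hxG
  · simpa [hxG] using hf1 x

/-- If `p` is at least `1 - δ` on `m + 1, …, m + j`, then `∫ cos(2π 3ᵐ t) dν(t)` is close to `1`. -/
theorem IsCantorProductMeasure.le_integral_cos {p : ℕ → ℝ} {ζ : Measure (ℕ → ℝ)}
    (hζ : IsCantorProductMeasure p ζ) (hp : ∀ n, 1 ≤ n → 0 ≤ p n ∧ p n ≤ 1) {m j : ℕ} {δ : ℝ}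
    (hδ1 : δ ≤ 1) (hflat : ∀ n ∈ Finset.Icc (m + 1) (m + j), 1 - δ ≤ p n) :
    1 - 2 * (j * δ) - (2 * Real.pi * 3⁻¹ ^ j) ^ 2 / 2 ≤
      ∫ t, Real.cos (2 * Real.pi * 3 ^ m * t) ∂(ζ.map cantorCoord) := by
  have := hζ.1
  have hθ := hζ.aemeasurable_cantorCoord hp
  have hcos : Continuous fun t : ℝ => Real.cos (2 * Real.pi * 3 ^ m * t) := by fun_prop
  rw [integral_map hθ hcos.aestronglyMeasurable]
  set s := Finset.Icc (m + 1) (m + j) with hs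
  set G : Set (ℕ → ℝ) := {x | ∀ n ∈ s, x n = 0} with hG
  set ε := (2 * Real.pi * 3⁻¹ ^ j) ^ 2 / 2 with hε
  have hGm : MeasurableSet G := by
    have : G = ⋂ n ∈ s, (fun x : ℕ → ℝ => x n) ⁻¹' {0} := by ext; simp [hG]
    rw [this]
    exact Finset.measurableSet_biInter _ fun n _ =>
      measurable_pi_apply n (measurableSet_singleton 0)
  have hs1 : ∀ n ∈ s, 1 ≤ n := fun n hn => by rw [hs, Finset.mem_Icc] at hn; omega
  have hGreal : ζ.real G = ∏ n ∈ s, p n := by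
    rw [Measure.real, hζ.measure_forall_eq_zero s hs1, ENNReal.toReal_prod]
    exact Finset.prod_congr rfl fun n hn => ENNReal.toReal_ofReal (hp n (hs1 n hn)).1
  have hGlow : 1 - j * δ ≤ ζ.real G := by
    have hbern := one_add_mul_le_pow (a := -δ) (by linarith) j
    have hprod : ∏ _n ∈ s, (1 - δ) ≤ ∏ n ∈ s, p n :=
      Finset.prod_le_prod (fun _ _ => by linarith) hflat
    rw [Finset.prod_const, hs, Nat.card_Icc, show m + j + 1 - (m + 1) = j by omega] at hprod
    rw [hGreal]
    rw [← sub_eq_add_neg] at hbern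
    linarith
  have hint : Integrable (fun x => Real.cos (2 * Real.pi * 3 ^ m * cantorCoord x)) ζ :=
    .of_bound (hcos.measurable.comp_aemeasurable hθ).aestronglyMeasurable 1
      (.of_forall fun x => Real.abs_cos_le_one _)
  have hlow : ∀ᵐ x ∂ζ, x ∈ G → 1 - ε ≤ Real.cos (2 * Real.pi * 3 ^ m * cantorCoord x) := by
    filter_upwards [hζ.ae_mem hp] with x hx hxG
    obtain ⟨z, hz⟩ := exists_int_abs_sub_le hx hxG
    rw [mul_assoc _ (3 ^ m)]
    exact one_sub_le_cos_two_pi_mul z hz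
  have hmain := le_integral_of_ae_le_on hint (fun _ => Real.neg_one_le_cos _) hGm hlow
  have hεG : ζ.real G * ε ≤ ε := mul_le_of_le_one_left (by positivity) measureReal_le_one
  linarith

/-- Assume `∑_{n≥1}(1-pₙ) = ∞` and that for every `δ > 0` and `k ∈ ℕ` there is
`n ≥ 1` with `pₙ, …, p_{n+k} ∈ [1-δ, 1]`. Then there is a sequence `(a_j)` of positive integers
with `a_j → ∞` and `∫ cos(2π a_j t) dν(t) → 1` (equivalently, the multiplication unitaries
`f(t) ↦ e^{2πi a_j t} f(t)` on `L²(ν)` converge strongly to the identity). -/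
theorem exists_sequence_tendsto_one
    (p : ℕ → ℝ) (hp : ∀ n, 1 ≤ n → 0 ≤ p n ∧ p n ≤ 1)
    (ζ : Measure (ℕ → ℝ)) (hζ : IsCantorProductMeasure p ζ)
    (ν : Measure ℝ) (hν : ν = ζ.map cantorCoord)
    (hdiv : ¬ Summable (fun n : ℕ => 1 - p (n + 1)))
    (hflat : ∀ δ : ℝ, 0 < δ → ∀ k : ℕ, ∃ n : ℕ, 1 ≤ n ∧ ∀ i ≤ k, 1 - δ ≤ p (n + i)) :
    ∃ a : ℕ → ℕ, (∀ j, 0 < a j) ∧ Tendsto a atTop atTop ∧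
      Tendsto (fun j => ∫ t, Real.cos (2 * Real.pi * (a j : ℝ) * t) ∂ν)
        atTop (nhds 1) := by
  choose n hn1 hn using fun j : ℕ => hflat (1 / ((j : ℝ) + 1) ^ 2) (by positivity) (2 * j)
  have hpow : Tendsto (fun j => 3 ^ (n j + j) : ℕ → ℕ) atTop atTop :=
    tendsto_atTop_mono (fun j => (Nat.le_add_left j (n j)).trans (Nat.lt_pow_self (by norm_num)).le)
      tendsto_id
  refine ⟨fun j => 3 ^ (n j + j), fun j => by positivity, hpow, ?_⟩
  have hprob := hζ.1
  have hlow : ∀ j : ℕ, 1 - 2 * (1 / ((j : ℝ) + 1)) - (2 * Real.pi * 3⁻¹ ^ j) ^ 2 / 2 ≤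
      ∫ t, Real.cos (2 * Real.pi * ((3 ^ (n j + j) : ℕ) : ℝ) * t) ∂ν := by
    intro j
    have hδ : 1 / ((j : ℝ) + 1) ^ 2 ≤ 1 := by
      rw [div_le_one (by positivity)]
      exact one_le_pow₀ (by linarith [Nat.cast_nonneg (α := ℝ) j])
    have hmain := hζ.le_integral_cos hp (m := n j + j) (j := j) hδ fun i hi => by
      rw [Finset.mem_Icc] at hi
      have h := hn j (i - n j) (by omega)
      rwa [show n j + (i - n j) = i by omega] at h
    have hjδ : (j : ℝ) * (1 / ((j : ℝ) + 1) ^ 2) ≤ 1 / ((j : ℝ) + 1) := by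
      rw [mul_one_div, div_le_div_iff₀ (by positivity) (by positivity)]
      nlinarith [Nat.cast_nonneg (α := ℝ) j]
    rw [hν]
    push_cast
    linarith
  have hup : ∀ j : ℕ, ∫ t, Real.cos (2 * Real.pi * ((3 ^ (n j + j) : ℕ) : ℝ) * t) ∂ν ≤ 1 := by
    intro j
    have hprob : IsProbabilityMeasure ν := by
      rw [hν]
      exact Measure.isProbabilityMeasure_map (hζ.aemeasurable_cantorCoord hp)
    have hbound := norm_integral_le_of_norm_le_const (μ := ν) (C := 1)
      (f := fun t => Real.cos (2 * Real.pi * ((3 ^ (n j + j) : ℕ) : ℝ) * t))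
      (.of_forall fun t => Real.abs_cos_le_one _)
    rw [probReal_univ, mul_one] at hbound
    exact (le_abs_self _).trans hbound
  have hlim : Tendsto (fun j : ℕ => 1 - 2 * (1 / ((j : ℝ) + 1)) -
      (2 * Real.pi * 3⁻¹ ^ j) ^ 2 / 2) atTop (nhds 1) := by
    have hinv := tendsto_one_div_add_atTop_nhds_zero_nat (𝕜 := ℝ)
    have hgeom := tendsto_pow_atTop_nhds_zero_of_lt_one (r := (3 : ℝ)⁻¹) (by norm_num)
      (by norm_num)
    simpa using ((hinv.const_mul 2).const_sub 1).sub
      (((hgeom.const_mul (2 * Real.pi)).pow 2).div_const 2)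
  exact tendsto_of_tendsto_of_tendsto_of_le_of_le hlim tendsto_const_nhds hlow hup
end

section
/- Let Γ be a finitely generated group. Assume at least one of the following: (1) Γ admits an affine isometric action α on a real Hilbert space with δ(α) = 0; (2) Γ admits an affine isometric action α with δ(α) < ∞ that has almost fixed points, i.e. for every finite subset F ⊆ Γ and every ε > 0 there exists x ∈ H with ‖α_g(x) - x‖ ≤ ε for all g ∈ F; (3) Γ admits an affine isometric action α on a real Hilbert space H such that ‖α_g(0)‖ / |g|^{1/2} → ∞ as |g| → ∞, where |·| is the word length with respect to some finite symmetric generating set of Γ. Then Γ has the Liouville property: for every adapted probability measure μ on Γ, every bounded function f : Γ → ℝ satisfying f(g) = ∑_{h∈Γ} μ(h) f(gh) for all g ∈ Γ is constant. -/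
open MeasureTheory Filter
open scoped ENNReal

noncomputable section

/-- The word length of `g` with respect to a generating set `S`. -/
def wordLength {G : Type*} [Group G] (S : Finset G) (g : G) : ℕ :=
  sInf {n : ℕ | ∃ l : List G, l.length = n ∧ (∀ x ∈ l, x ∈ S) ∧ l.prod = g}

end

section RandomWalk

variable {G : Type*} [Group G]

/-- The expectation of a function of the position at time `n` of the random walk on `G` started at
the identity whose steps are distributed according to `μ`. -/
noncomputable def walkExp (μ : G →₀ ℝ) : ℕ → (G → ℝ) →ₗ[ℝ] ℝ
  | 0 => LinearMap.proj 1
  | n + 1 => ∑ s ∈ μ.support, μ s • (walkExp μ n).comp (LinearMap.funLeft ℝ ℝ (s * ·))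

open Classical in
/-- The distribution of the random walk at time `n`. -/
noncomputable def walkDensity (μ : G →₀ ℝ) (n : ℕ) (g : G) : ℝ :=
  walkExp μ n (Pi.single g 1)

/-- The Shannon entropy of the random walk at time `n`. -/
noncomputable def walkEntropy (μ : G →₀ ℝ) (n : ℕ) : ℝ :=
  walkExp μ n (fun g => -Real.log (walkDensity μ n g))

variable {μ : G →₀ ℝ}

lemma walkExp_zero (F : G → ℝ) : walkExp μ 0 F = F 1 := rfl

lemma walkExp_succ (n : ℕ) (F : G → ℝ) :
    walkExp μ (n + 1) F = ∑ s ∈ μ.support, μ s * walkExp μ n (fun g => F (s * g)) := by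
  simp [walkExp, LinearMap.sum_apply]
  rfl

lemma walkExp_mono (hμ : ∀ g, 0 ≤ μ g) (n : ℕ) {F F' : G → ℝ} (h : ∀ g, F g ≤ F' g) :
    walkExp μ n F ≤ walkExp μ n F' := by
  induction n generalizing F F' with
  | zero => exact h 1
  | succ n ih =>
    rw [walkExp_succ, walkExp_succ]
    exact Finset.sum_le_sum fun s _ => mul_le_mul_of_nonneg_left (ih fun g => h _) (hμ s)

lemma walkExp_const (hsum : ∑ g ∈ μ.support, μ g = 1) (n : ℕ) (c : ℝ) :
    walkExp μ n (fun _ => c) = c := by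
  induction n with
  | zero => rfl
  | succ n ih => rw [walkExp_succ, ih, ← Finset.sum_mul, hsum, one_mul]

lemma walkExp_harmonic {f : G → ℝ} (hf : ∀ g : G, f g = ∑ h ∈ μ.support, μ h * f (g * h))
    (n : ℕ) (a : G) : walkExp μ n (fun g => f (a * g)) = f a := by
  induction n generalizing a with
  | zero => simp [walkExp_zero]
  | succ n ih =>
    rw [walkExp_succ, hf a]
    exact Finset.sum_congr rfl fun s _ => by simp only [← mul_assoc, ih]

lemma walkExp_add (m n : ℕ) (F : G → ℝ) :
    walkExp μ (m + n) F = walkExp μ m (fun g => walkExp μ n (fun h => F (g * h))) := by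
  induction m generalizing F with
  | zero => simp [walkExp_zero]
  | succ m ih =>
    rw [Nat.add_right_comm, walkExp_succ, walkExp_succ]
    simp only [ih, mul_assoc]

lemma walkExp_one (F : G → ℝ) : walkExp μ 1 F = ∑ s ∈ μ.support, μ s * F s := by
  simp [walkExp_succ, walkExp_zero]

lemma walkExp_succ_right (n : ℕ) (F : G → ℝ) :
    walkExp μ (n + 1) F = ∑ s ∈ μ.support, μ s * walkExp μ n (fun g => F (g * s)) := by
  rw [walkExp_add]
  simp only [walkExp_one]
  rw [show (fun g => ∑ s ∈ μ.support, μ s * F (g * s))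
    = ∑ s ∈ μ.support, μ s • (fun g => F (g * s)) by ext; simp, map_sum]
  simp

lemma walkExp_inv (hsymm : ∀ g, μ g⁻¹ = μ g) (n : ℕ) (F : G → ℝ) :
    walkExp μ n (fun g => F g⁻¹) = walkExp μ n F := by
  induction n generalizing F with
  | zero => simp [walkExp_zero]
  | succ n ih =>
    rw [walkExp_succ, walkExp_succ_right]
    refine Finset.sum_nbij' (·⁻¹) (·⁻¹) ?_ ?_ ?_ ?_ ?_
    · intro s hs; simpa [hsymm] using hs
    · intro s hs; simpa [hsymm] using hs
    · simp
    · simp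
    · intro s _
      rw [hsymm, ← ih fun g => F (g * s⁻¹)]
      simp only [mul_inv_rev]

lemma exists_walkExp_congr (μ : G →₀ ℝ) (n : ℕ) :
    ∃ T : Finset G, ∀ F F' : G → ℝ, (∀ g ∈ T, F g = F' g) → walkExp μ n F = walkExp μ n F' := by
  classical
  induction n with
  | zero => exact ⟨{1}, fun F F' h => h 1 (by simp)⟩
  | succ n ih =>
    obtain ⟨T, hT⟩ := ih
    refine ⟨μ.support.biUnion fun s => T.image (s * ·), fun F F' h => ?_⟩
    rw [walkExp_succ, walkExp_succ]
    refine Finset.sum_congr rfl fun s hs => ?_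
    rw [hT _ _ fun g hg => h _ (Finset.mem_biUnion.2 ⟨s, hs, Finset.mem_image_of_mem _ hg⟩)]

lemma exists_walkExp_eq_sum (μ : G →₀ ℝ) (n : ℕ) :
    ∃ T : Finset G, ∀ T' : Finset G, T ⊆ T' → ∀ F : G → ℝ,
      walkExp μ n F = ∑ g ∈ T', walkDensity μ n g * F g := by
  classical
  obtain ⟨T, hT⟩ := exists_walkExp_congr μ n
  refine ⟨T, fun T' hTT F => ?_⟩
  rw [hT F (∑ g ∈ T', F g • Pi.single g 1), map_sum]
  · refine Finset.sum_congr rfl fun g _ => ?_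
    rw [map_smul, smul_eq_mul, mul_comm, walkDensity]
  · intro g hg
    simp [Finset.sum_apply, Pi.single_apply, hTT hg]

lemma walkDensity_nonneg (hμ : ∀ g, 0 ≤ μ g) (n : ℕ) (g : G) : 0 ≤ walkDensity μ n g := by
  classical
  rw [← map_zero (walkExp μ n)]
  refine walkExp_mono hμ n fun h => ?_
  by_cases hh : h = g
  · subst hh; simp
  · simp [hh]

lemma walkDensity_succ (n : ℕ) (g : G) :
    walkDensity μ (n + 1) g = ∑ s ∈ μ.support, μ s * walkDensity μ n (s⁻¹ * g) := by
  classical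
  rw [walkDensity, walkExp_succ]
  refine Finset.sum_congr rfl fun s _ => ?_
  rw [walkDensity]
  congr 2
  ext k
  simp [Pi.single_apply, eq_inv_mul_iff_mul_eq]

lemma mul_walkDensity_le (hμ : ∀ g, 0 ≤ μ g) (n : ℕ) {s : G} (hs : s ∈ μ.support) (g : G) :
    μ s * walkDensity μ n g ≤ walkDensity μ (n + 1) (s * g) := by
  rw [walkDensity_succ]
  have := Finset.single_le_sum (f := fun r => μ r * walkDensity μ n (r⁻¹ * (s * g)))
    (fun r _ => mul_nonneg (hμ r) (walkDensity_nonneg hμ n _)) hs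
  simpa using this

/-- Expectations are monotone with respect to inequalities on the support of the walk. -/
lemma walkExp_le_of_density_pos (hμ : ∀ g, 0 ≤ μ g) (n : ℕ) {F F' : G → ℝ}
    (h : ∀ g, 0 < walkDensity μ n g → F g ≤ F' g) : walkExp μ n F ≤ walkExp μ n F' := by
  obtain ⟨T, hT⟩ := exists_walkExp_eq_sum μ n
  rw [hT T subset_rfl, hT T subset_rfl]
  refine Finset.sum_le_sum fun g _ => ?_
  rcases (walkDensity_nonneg hμ n g).eq_or_lt with h0 | h0
  · simp [← h0]
  · exact mul_le_mul_of_nonneg_left (h g h0) h0.le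

lemma walkExp_div_density_le_tsum (n : ℕ) {w : G → ℝ} (hw : ∀ g, 0 ≤ w g)
    (hsum : Summable w) : walkExp μ n (fun g => w g / walkDensity μ n g) ≤ ∑' g, w g := by
  obtain ⟨T, hT⟩ := exists_walkExp_eq_sum μ n
  rw [hT T subset_rfl]
  refine (Finset.sum_le_sum fun g _ => ?_).trans (hsum.sum_le_tsum T fun g _ => hw g)
  rcases eq_or_ne (walkDensity μ n g) 0 with h0 | h0
  · simpa [h0] using hw g
  · rw [mul_div_cancel₀ _ h0]

lemma walkExp_translate_density_ratio_le (hμ : ∀ g, 0 ≤ μ g) (n : ℕ) (s : G) {u : G → ℝ}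
    (hu : ∀ g, 0 ≤ u g) :
    walkExp μ n (fun g => u (s * g) * walkDensity μ (n + 1) (s * g) / walkDensity μ n g)
      ≤ walkExp μ (n + 1) u := by
  classical
  obtain ⟨T, hT⟩ := exists_walkExp_eq_sum μ n
  obtain ⟨T', hT'⟩ := exists_walkExp_eq_sum μ (n + 1)
  have hnn : ∀ g, 0 ≤ walkDensity μ (n + 1) g * u g :=
    fun g => mul_nonneg (walkDensity_nonneg hμ _ _) (hu g)
  rw [hT T subset_rfl, hT' (T' ∪ T.image (s * ·)) Finset.subset_union_left]
  calc _ ≤ ∑ g ∈ T, walkDensity μ (n + 1) (s * g) * u (s * g) := by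
        refine Finset.sum_le_sum fun g _ => ?_
        rcases eq_or_ne (walkDensity μ n g) 0 with h0 | h0
        · simpa [h0] using hnn _
        · rw [mul_div_cancel₀ _ h0, mul_comm]
    _ = ∑ k ∈ T.image (s * ·), walkDensity μ (n + 1) k * u k := by
        rw [Finset.sum_image (fun a _ b _ h => mul_left_cancel h)]
    _ ≤ _ := Finset.sum_le_sum_of_subset_of_nonneg Finset.subset_union_right fun g _ _ => hnn g

/-- Gibbs' inequality: entropy is bounded by the expectation of any weight with finite partition
function. -/
lemma walkEntropy_le (hμ : ∀ g, 0 ≤ μ g) (n : ℕ) {w : G → ℝ}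
    (hw : Summable fun g => Real.exp (-w g)) :
    walkEntropy μ n ≤ walkExp μ n w + ∑' g, Real.exp (-w g) := by
  have h1 := walkExp_div_density_le_tsum (μ := μ) n (fun g => (Real.exp_pos (-w g)).le) hw
  have h2 : walkEntropy μ n
      ≤ walkExp μ n (w + fun g => Real.exp (-w g) / walkDensity μ n g) := by
    refine walkExp_le_of_density_pos hμ n fun g hg => ?_
    have := Real.add_one_le_exp (-w g - Real.log (walkDensity μ n g))
    rw [Real.exp_sub, Real.exp_log hg] at this
    simp only [Pi.add_apply]
    linarith
  rw [map_add] at h2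
  linarith

/-- The Kullback–Leibler divergence between the `s`-translate of the walk at time `n` and the walk
at time `n + 1`. -/
noncomputable def walkDivergence (μ : G →₀ ℝ) (n : ℕ) (s : G) : ℝ :=
  walkExp μ n fun g => Real.log (walkDensity μ n g) - Real.log (walkDensity μ (n + 1) (s * g))

lemma sum_walkDivergence (hsum : ∑ g ∈ μ.support, μ g = 1) (n : ℕ) :
    ∑ s ∈ μ.support, μ s * walkDivergence μ n s = walkEntropy μ (n + 1) - walkEntropy μ n := by
  have key : ∀ s, walkDivergence μ n s
      = walkExp μ n (fun g => -Real.log (walkDensity μ (n + 1) (s * g))) - walkEntropy μ n := by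
    intro s
    rw [walkDivergence, walkEntropy, ← map_sub]
    congr 1
    ext g
    simp only [Pi.sub_apply]
    ring
  simp only [key, mul_sub, Finset.sum_sub_distrib]
  rw [← Finset.sum_mul, hsum, one_mul, walkEntropy.eq_def μ (n + 1), walkExp_succ]

/-- A variational lower bound for the divergence. -/
lemma walkExp_translate_le_divergence (hμ : ∀ g, 0 ≤ μ g) (hsum : ∑ g ∈ μ.support, μ g = 1)
    (n : ℕ) {s : G} (hs : s ∈ μ.support) (F : G → ℝ) :
    walkExp μ n (fun g => F (s * g))
      ≤ walkDivergence μ n s + (walkExp μ (n + 1) (fun g => Real.exp (F g)) - 1) := by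
  have h1 := walkExp_translate_density_ratio_le hμ n s (fun g => (Real.exp_pos (F g)).le)
  have h2 : walkExp μ n ((fun _ => 1) + fun g => F (s * g))
      ≤ walkExp μ n ((fun g => Real.log (walkDensity μ n g)
          - Real.log (walkDensity μ (n + 1) (s * g)))
        + fun g => Real.exp (F (s * g)) * walkDensity μ (n + 1) (s * g) / walkDensity μ n g) := by
    refine walkExp_le_of_density_pos hμ n fun g hg => ?_
    have hpos : 0 < walkDensity μ (n + 1) (s * g) :=
      (mul_pos ((hμ s).lt_of_ne' (Finsupp.mem_support_iff.1 hs)) hg).trans_le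
        (mul_walkDensity_le hμ n hs g)
    have := Real.add_one_le_exp (F (s * g) + Real.log (walkDensity μ (n + 1) (s * g))
      - Real.log (walkDensity μ n g))
    rw [Real.exp_sub, Real.exp_add, Real.exp_log hg, Real.exp_log hpos] at this
    simp only [Pi.add_apply]
    linarith
  rw [map_add, map_add, walkExp_const hsum] at h2
  change _ ≤ walkDivergence μ n s + _ at h2
  linarith

lemma walkDivergence_nonneg (hμ : ∀ g, 0 ≤ μ g) (hsum : ∑ g ∈ μ.support, μ g = 1)
    (n : ℕ) {s : G} (hs : s ∈ μ.support) : 0 ≤ walkDivergence μ n s := by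
  simpa [walkExp_const hsum] using walkExp_translate_le_divergence hμ hsum n hs (fun _ => 0)

lemma mul_walkDivergence_le (hμ : ∀ g, 0 ≤ μ g) (hsum : ∑ g ∈ μ.support, μ g = 1)
    (n : ℕ) {s : G} (hs : s ∈ μ.support) :
    μ s * walkDivergence μ n s ≤ walkEntropy μ (n + 1) - walkEntropy μ n := by
  rw [← sum_walkDivergence hsum]
  exact Finset.single_le_sum (f := fun r => μ r * walkDivergence μ n r)
    (fun r hr => mul_nonneg (hμ r) (walkDivergence_nonneg hμ hsum n hr)) hs

lemma harmonic_increment_le (hμ : ∀ g, 0 ≤ μ g) (hsum : ∑ g ∈ μ.support, μ g = 1)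
    {f : G → ℝ} (hf : ∀ g : G, f g = ∑ h ∈ μ.support, μ h * f (g * h))
    {C : ℝ} (hC : ∀ g, |f g| ≤ C) (n : ℕ) {s : G} (hs : s ∈ μ.support) (a : G)
    {t : ℝ} (ht : 0 < t) (htC : t * (2 * C) ≤ 1) :
    t * (f (a * s) - f a) ≤ walkDivergence μ n s + (t * (2 * C)) ^ 2 := by
  have h := walkExp_translate_le_divergence hμ hsum n hs (fun g => t * (f (a * g) - f a))
  have lin : ∀ (m : ℕ) (b : G),
      walkExp μ m (fun g => t * (f (b * g) - f a)) = t * (f b - f a) := by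
    intro m b
    rw [show (fun g => t * (f (b * g) - f a))
      = t • ((fun g => f (b * g)) - fun _ => f a) by ext; simp, map_smul, map_sub,
      walkExp_harmonic hf, walkExp_const hsum, smul_eq_mul]
  have hexp : walkExp μ (n + 1) (fun g => Real.exp (t * (f (a * g) - f a)))
      ≤ walkExp μ (n + 1) ((fun g => t * (f (a * g) - f a))
        + fun _ => 1 + (t * (2 * C)) ^ 2) := by
    refine walkExp_mono hμ _ fun g => ?_
    have hd : |t * (f (a * g) - f a)| ≤ t * (2 * C) := by
      rw [abs_mul, abs_of_pos ht]
      refine mul_le_mul_of_nonneg_left ?_ ht.le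
      calc _ ≤ |f (a * g)| + |f a| := abs_sub _ _
        _ ≤ _ := by linarith [hC (a * g), hC a]
    have hq := (abs_le.1 (Real.abs_exp_sub_one_sub_id_le (hd.trans htC))).2
    have hsq := sq_le_sq' (by linarith [(abs_le.1 hd).1]) (abs_le.1 hd).2
    simp only [Pi.add_apply]
    linarith
  rw [map_add, lin, walkExp_const hsum] at hexp
  simp only [← mul_assoc a s] at h
  rw [lin] at h
  linarith

/-- If the entropy increments of the walk are not bounded below by a positive constant, then bounded
harmonic functions are constant. -/
theorem harmonic_const_of_entropy (hμ : ∀ g, 0 ≤ μ g) (hsum : ∑ g ∈ μ.support, μ g = 1)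
    (hsymm : ∀ g, μ g⁻¹ = μ g) (hgen : Subgroup.closure (μ.support : Set G) = ⊤)
    (hent : ∀ ε > 0, ∃ n, walkEntropy μ (n + 1) - walkEntropy μ n ≤ ε)
    {f : G → ℝ} (hbdd : ∃ C : ℝ, ∀ g, |f g| ≤ C)
    (hf : ∀ g : G, f g = ∑ h ∈ μ.support, μ h * f (g * h)) (g h : G) : f g = f h := by
  obtain ⟨C, hC⟩ := hbdd
  have hC0 : 0 ≤ C := (abs_nonneg _).trans (hC 1)
  have hle : ∀ s ∈ μ.support, ∀ a, f (a * s) ≤ f a := by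
    intro s hs a
    have hs0 : 0 < μ s := (hμ s).lt_of_ne' (Finsupp.mem_support_iff.1 hs)
    by_contra! hlt
    set d := f (a * s) - f a with hd
    have hd0 : 0 < d := by linarith
    have hd2 : d ≤ 2 * C := by
      have := abs_le.1 (hC (a * s)); have := abs_le.1 (hC a); linarith
    have hCpos : 0 < C := by linarith
    set t := d / (2 * (2 * C) ^ 2) with ht
    have ht0 : 0 < t := by positivity
    have htC : t * (2 * C) ≤ 1 := by
      rw [ht, div_mul_eq_mul_div, div_le_one (by positivity)]
      nlinarith
    obtain ⟨n, hn⟩ := hent (μ s * (t * d / 4)) (by positivity)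
    have h1 := harmonic_increment_le hμ hsum hf hC n hs a ht0 htC
    have h2 := le_of_mul_le_mul_left ((mul_walkDivergence_le hμ hsum n hs).trans hn) hs0
    have h3 : (t * (2 * C)) ^ 2 = t * d / 2 := by rw [ht]; field_simp
    rw [h3, ← hd] at h1
    have : 0 < t * d := by positivity
    linarith
  have heq : ∀ s ∈ μ.support, ∀ a, f (a * s) = f a := by
    intro s hs a
    refine le_antisymm (hle s hs a) ?_
    simpa using hle s⁻¹ (by simpa [hsymm] using hs) (a * s)
  have hall : ∀ k : G, ∀ a, f (a * k) = f a := by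
    intro k
    have hk : k ∈ Subgroup.closure (μ.support : Set G) := hgen ▸ Subgroup.mem_top k
    induction hk using Subgroup.closure_induction with
    | mem s hs => exact heq s hs
    | one => simp
    | mul x y _ _ hx hy => intro a; rw [← mul_assoc, hy, hx]
    | inv x _ hx => intro a; simpa using (hx (a * x⁻¹)).symm
  simpa using (hall (g⁻¹ * h) g).symm

lemma walkEntropy_zero : walkEntropy μ 0 = 0 := by
  classical
  simp [walkEntropy, walkExp_zero, walkDensity]

lemma exists_entropy_increment_le {c C : ℝ} (h : ∀ k : ℕ, walkEntropy μ (2 ^ k) ≤ c * 2 ^ k + C)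
    {ε : ℝ} (hε : c < ε) : ∃ n, walkEntropy μ (n + 1) - walkEntropy μ n ≤ ε := by
  by_contra! hlt
  have hlin : ∀ n : ℕ, ε * n ≤ walkEntropy μ n := by
    intro n
    induction n with
    | zero => simp [walkEntropy_zero]
    | succ n ih => push_cast; linarith [hlt n]
  obtain ⟨k, hk⟩ := pow_unbounded_of_one_lt (C / (ε - c)) (one_lt_two (α := ℝ))
  rw [div_lt_iff₀ (by linarith)] at hk
  have h1 := hlin (2 ^ k)
  push_cast at h1
  linarith [h k]

end RandomWalk

section AffineAction

lemma norm_orbit_inv_mul {G : Type*} [Group G] {H : Type*} [SeminormedAddCommGroup H]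
    {α : G → H → H} (hiso : ∀ g, Isometry (α g))
    (hmul : ∀ g h x, α (g * h) x = α g (α h x)) (x : H) (g h : G) :
    ‖α (g⁻¹ * h) x - x‖ = ‖(α h x - x) - (α g x - x)‖ := by
  have h1 : α g (α (g⁻¹ * h) x) = α h x := by rw [← hmul, mul_inv_cancel_left]
  rw [sub_sub_sub_cancel_right, ← dist_eq_norm, ← dist_eq_norm, ← h1, (hiso g).dist_eq]

variable {G : Type*} [Group G] {H : Type*} [NormedAddCommGroup H] [InnerProductSpace ℝ H]
  {μ : G →₀ ℝ} {α : G → H → H}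

lemma walkExp_walkExp_norm_sub_sq_le (hsum : ∑ g ∈ μ.support, μ g = 1) (n : ℕ) (b : G → H) :
    walkExp μ n (fun g => walkExp μ n (fun h => ‖b h - b g‖ ^ 2))
      ≤ 2 * walkExp μ n (fun g => ‖b g‖ ^ 2) := by
  obtain ⟨T, hT⟩ := exists_walkExp_eq_sum μ n
  have h1 : ∑ g ∈ T, walkDensity μ n g = 1 := by
    simpa [walkExp_const hsum] using (hT T subset_rfl fun _ => 1).symm
  simp only [hT T subset_rfl]
  set p := walkDensity μ n
  have h2 : 0 ≤ ∑ g ∈ T, p g * ∑ h ∈ T, p h * inner ℝ (b h) (b g) := by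
    have := real_inner_self_nonneg (x := ∑ g ∈ T, p g • b g)
    rw [inner_sum] at this
    simpa only [inner_smul_right, sum_inner, real_inner_smul_left] using this
  have h3 : ∀ g ∈ T, p g * ∑ h ∈ T, p h * ‖b h - b g‖ ^ 2
      = p g * (∑ h ∈ T, p h * ‖b h‖ ^ 2) + p g * ‖b g‖ ^ 2
        - 2 * (p g * ∑ h ∈ T, p h * inner ℝ (b h) (b g)) := by
    intro g _
    have : ∑ h ∈ T, p h * ‖b h - b g‖ ^ 2 = (∑ h ∈ T, p h * ‖b h‖ ^ 2)
        + (∑ h ∈ T, p h) * ‖b g‖ ^ 2 - 2 * ∑ h ∈ T, p h * inner ℝ (b h) (b g) := by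
      rw [Finset.sum_mul, Finset.mul_sum, ← Finset.sum_add_distrib, ← Finset.sum_sub_distrib]
      refine Finset.sum_congr rfl fun h _ => ?_
      rw [norm_sub_sq_real]
      ring
    rw [this, h1]
    ring
  rw [Finset.sum_congr rfl h3, Finset.sum_sub_distrib, Finset.sum_add_distrib, ← Finset.sum_mul,
    h1, ← Finset.mul_sum]
  linarith

/-- The orbit of a symmetric random walk under an affine isometric action is at most diffusive. -/
lemma walkExp_two_pow_norm_sq_le (hsum : ∑ g ∈ μ.support, μ g = 1) (hsymm : ∀ g, μ g⁻¹ = μ g)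
    (hiso : ∀ g, Isometry (α g))
    (hmul : ∀ g h x, α (g * h) x = α g (α h x)) (x : H) (k : ℕ) :
    walkExp μ (2 ^ k) (fun g => ‖α g x - x‖ ^ 2)
      ≤ 2 ^ k * ∑ s ∈ μ.support, μ s * ‖α s x - x‖ ^ 2 := by
  induction k with
  | zero => simp [walkExp_one]
  | succ k ih =>
    rw [pow_succ, mul_two, walkExp_add, ← walkExp_inv hsymm]
    simp only [norm_orbit_inv_mul hiso hmul]
    refine (walkExp_walkExp_norm_sub_sq_le hsum _ _).trans ?_
    rw [pow_succ]
    linarith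

lemma exists_entropy_increment_le_of_summable (hμ : ∀ g, 0 ≤ μ g)
    (hsum : ∑ g ∈ μ.support, μ g = 1) (hsymm : ∀ g, μ g⁻¹ = μ g)
    (hiso : ∀ g, Isometry (α g))
    (hmul : ∀ g h x, α (g * h) x = α g (α h x)) {x : H} {t ε : ℝ} (ht : 0 ≤ t)
    (hx : Summable fun g => Real.exp (-(t * ‖α g x - x‖ ^ 2)))
    (hε : t * ∑ s ∈ μ.support, μ s * ‖α s x - x‖ ^ 2 < ε) :
    ∃ n, walkEntropy μ (n + 1) - walkEntropy μ n ≤ ε := by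
  refine exists_entropy_increment_le
    (C := ∑' g, Real.exp (-(t * ‖α g x - x‖ ^ 2))) (fun k => (walkEntropy_le hμ _ hx).trans ?_) hε
  gcongr
  rw [show (fun g => t * ‖α g x - x‖ ^ 2) = t • fun g => ‖α g x - x‖ ^ 2 from rfl, map_smul,
    smul_eq_mul]
  have := mul_le_mul_of_nonneg_left
    (walkExp_two_pow_norm_sq_le hsum hsymm hiso hmul x k) ht
  linarith

end AffineAction

section Growth

lemma summable_exp_neg_mul_of_growth {X : Type*} {φ : X → ℕ} {c t : ℝ} (hct : c < t)
    (hfin : ∀ n, {x | φ x = n}.Finite)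
    (hcard : ∀ᶠ n : ℕ in atTop, ({x | φ x = n}.ncard : ℝ) ≤ Real.exp (c * n)) :
    Summable fun x => Real.exp (-(t * φ x)) := by
  rw [← (Equiv.sigmaFiberEquiv φ).summable_iff]
  refine (summable_sigma_of_nonneg fun y => (Real.exp_pos _).le).2 ?_
  have hF : ∀ n, Finite {x // φ x = n} := hfin
  refine ⟨fun n => Summable.of_finite, ?_⟩
  have htsum : ∀ n : ℕ, ∑' y : {x // φ x = n},
      Real.exp (-(t * φ (Equiv.sigmaFiberEquiv φ ⟨n, y⟩)))
      = ({x | φ x = n}.ncard : ℝ) * Real.exp (-(t * n)) := by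
    intro n
    rw [← Nat.card_coe_set_eq, ← nsmul_eq_mul]
    change _ = Nat.card {x // φ x = n} • _
    rw [← tsum_const]
    refine tsum_congr fun y => ?_
    simp [Equiv.sigmaFiberEquiv, y.2]
  simp only [htsum]
  have hgeo : Summable fun n : ℕ => Real.exp (c - t) ^ n :=
    summable_geometric_of_lt_one (Real.exp_pos _).le (Real.exp_lt_one_iff.2 (by linarith))
  refine hgeo.of_norm_bounded_eventually_nat ?_
  filter_upwards [hcard] with n hn
  rw [Real.norm_of_nonneg (by positivity), ← Real.exp_nat_mul]
  refine (mul_le_mul_of_nonneg_right hn (Real.exp_pos _).le).trans_eq ?_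
  rw [← Real.exp_add]
  ring_nf

lemma summable_exp_neg_mul_of_sublevel_growth {X : Type*} {ψ : X → ℝ} {c t : ℝ}
    (hct : c < t) (ht : 0 ≤ t) (hψ : ∀ x, 0 ≤ ψ x) (hfin : ∀ s : ℝ, {x | ψ x ≤ s}.Finite)
    (hne : ∃ x, ψ x ≤ 0)
    (hlog : ∀ᶠ s : ℝ in atTop, Real.log ({x | ψ x ≤ s}.ncard) / s ≤ c) :
    Summable fun x => Real.exp (-(t * ψ x)) := by
  have hsub : ∀ n : ℕ, {x | ⌈ψ x⌉₊ = n} ⊆ {x | ψ x ≤ n} := fun n x hx =>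
    (Nat.le_ceil (ψ x)).trans (by exact_mod_cast le_of_eq hx)
  have hcard : ∀ᶠ n : ℕ in atTop, ({x | ⌈ψ x⌉₊ = n}.ncard : ℝ) ≤ Real.exp (c * n) := by
    filter_upwards [tendsto_natCast_atTop_atTop.eventually hlog, eventually_gt_atTop 0] with n hn h0
    have hpos : 0 < {x | ψ x ≤ (n : ℝ)}.ncard := by
      obtain ⟨x, hx⟩ := hne
      exact (Set.ncard_pos (hfin n)).2 ⟨x, hx.trans n.cast_nonneg⟩
    rw [div_le_iff₀ (by exact_mod_cast h0), Real.log_le_iff_le_exp (by exact_mod_cast hpos)] at hn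
    refine le_trans ?_ hn
    exact_mod_cast Set.ncard_le_ncard (hsub n) (hfin n)
  have key := summable_exp_neg_mul_of_growth hct (fun n => (hfin n).subset (hsub n)) hcard
  refine (key.mul_left (Real.exp t)).of_nonneg_of_le (fun x => (Real.exp_pos _).le) fun x => ?_
  rw [← Real.exp_add, Real.exp_le_exp]
  have h1 : (⌈ψ x⌉₊ : ℝ) ≤ ψ x + 1 := (Nat.ceil_lt_add_one (hψ x)).le
  nlinarith

variable {G : Type*} [Group G] {S : Finset G}

lemma exists_list_length_eq_wordLength (hS : ∀ g ∈ S, g⁻¹ ∈ S)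
    (hgen : Subgroup.closure (S : Set G) = ⊤) (g : G) :
    ∃ l : List G, l.length = wordLength S g ∧ (∀ x ∈ l, x ∈ S) ∧ l.prod = g := by
  have hg : g ∈ (Subgroup.closure (S : Set G)).toSubmonoid := hgen ▸ Subgroup.mem_top g
  rw [Subgroup.closure_toSubmonoid] at hg
  obtain ⟨l, hl, hprod⟩ := Submonoid.exists_list_of_mem_closure hg
  refine Nat.sInf_mem (s := {n : ℕ | ∃ l : List G, l.length = n ∧ (∀ x ∈ l, x ∈ S) ∧ l.prod = g})
    ⟨l.length, l, rfl, fun x hx => (hl x hx).elim id fun h => ?_, hprod⟩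
  simpa using hS _ h

open scoped Pointwise in
lemma finite_wordLength_eq_and_ncard_le (hS : ∀ g ∈ S, g⁻¹ ∈ S)
    (hgen : Subgroup.closure (S : Set G) = ⊤) (n : ℕ) :
    {g | wordLength S g = n}.Finite ∧ {g | wordLength S g = n}.ncard ≤ S.card ^ n := by
  classical
  have hlist : ∀ l : List G, (∀ x ∈ l, x ∈ S) → l.prod ∈ S ^ l.length := by
    intro l
    induction l with
    | nil => simp
    | cons a l ih =>
      intro h
      rw [List.prod_cons, List.length_cons, pow_succ']
      exact Finset.mul_mem_mul (h a (by simp)) (ih fun x hx => h x (by simp [hx]))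
  have hsub : {g | wordLength S g = n} ⊆ ((S ^ n : Finset G) : Set G) := by
    rintro g rfl
    obtain ⟨l, hlen, hl, hprod⟩ := exists_list_length_eq_wordLength hS hgen g
    rw [← hlen]
    exact hprod ▸ hlist l hl
  refine ⟨(Finset.finite_toSet _).subset hsub, ?_⟩
  calc _ ≤ ((S ^ n : Finset G) : Set G).ncard := Set.ncard_le_ncard hsub (Finset.finite_toSet _)
    _ = (S ^ n).card := Set.ncard_coe_finset _
    _ ≤ _ := Finset.card_pow_le

lemma summable_exp_neg_mul_wordLength (hS : ∀ g ∈ S, g⁻¹ ∈ S)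
    (hgen : Subgroup.closure (S : Set G) = ⊤) {t : ℝ} (ht : (S.card : ℝ) < t) :
    Summable fun g => Real.exp (-(t * wordLength S g)) := by
  refine summable_exp_neg_mul_of_growth ht
    (fun n => (finite_wordLength_eq_and_ncard_le hS hgen n).1) (Eventually.of_forall fun n => ?_)
  calc (({g | wordLength S g = n}.ncard : ℕ) : ℝ) ≤ (S.card : ℝ) ^ n := by
        exact_mod_cast (finite_wordLength_eq_and_ncard_le hS hgen n).2
    _ ≤ Real.exp S.card ^ n := by
        gcongr
        linarith [Real.add_one_le_exp (S.card : ℝ)]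
    _ = _ := by rw [← Real.exp_nat_mul, mul_comm]

lemma summable_exp_neg_mul_sq_of_tendsto (hS : ∀ g ∈ S, g⁻¹ ∈ S)
    (hgen : Subgroup.closure (S : Set G) = ⊤) {ℓ : G → ℝ}
    (hℓ : Tendsto (fun g : G => ℓ g / Real.sqrt (wordLength S g))
      (Filter.comap (fun g : G => wordLength S g) atTop) atTop) {t : ℝ} (ht : 0 < t) :
    Summable fun g => Real.exp (-(t * ℓ g ^ 2)) := by
  have hcof : Tendsto (fun g : G => wordLength S g) cofinite atTop := by
    rw [← Nat.cofinite_eq_atTop]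
    exact Tendsto.cofinite_of_finite_preimage_singleton
      fun n => (finite_wordLength_eq_and_ncard_le hS hgen n).1
  refine (summable_exp_neg_mul_wordLength hS hgen
    (lt_add_one (S.card : ℝ))).of_norm_bounded_eventually ?_
  set M := ((S.card : ℝ) + 1) / t with hM
  have hM0 : 0 ≤ M := by positivity
  filter_upwards [(hℓ.mono_left hcof.le_comap).eventually_ge_atTop (Real.sqrt M),
    hcof.eventually_gt_atTop 0] with g hg h0
  have hpos : (0 : ℝ) < wordLength S g := by exact_mod_cast h0
  rw [Real.norm_of_nonneg (Real.exp_pos _).le, Real.exp_le_exp, neg_le_neg_iff]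
  rw [le_div_iff₀ (Real.sqrt_pos.2 hpos), ← Real.sqrt_mul hM0] at hg
  have h1 := (Real.sqrt_le_iff.1 hg).2
  calc ((S.card : ℝ) + 1) * wordLength S g = t * (M * wordLength S g) := by rw [hM]; field_simp
    _ ≤ _ := mul_le_mul_of_nonneg_left h1 ht.le

end Growth

/-- **Corollary on the Liouville property.** Let `Γ` be a finitely generated
group and `α` an affine isometric action of `Γ` on a real Hilbert space `H` (a homomorphism
into the bijective isometries of `H`; by Mazur–Ulam these are exactly the affine isometries).
Assume at least one of:
(1) `δ(α) = 0` (all sublevel sets `{g : ‖α_g 0‖² ≤ s}` are finite and `log N(s)/s → 0`);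
(2) `α` has almost fixed points and `δ(α) < ∞`;
(3) `‖α_g(0)‖ / |g|^{1/2} → ∞` as `|g| → ∞` for the word length `|·|` of some finite
    symmetric generating set `S` of `Γ`.
Then `Γ` has the Liouville property: for every adapted probability measure `μ` on `Γ`,
every bounded `μ`-harmonic function on `Γ` is constant. -/
theorem liouville_of_affine_isometric_action
    {G : Type*} [Group G] (hFG : Group.FG G)
    {H : Type*} [NormedAddCommGroup H] [InnerProductSpace ℝ H] [CompleteSpace H]
    (α : G → H → H)
    (hiso : ∀ g, Isometry (α g))
    (hone : ∀ x : H, α 1 x = x)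
    (hmul : ∀ g h x, α (g * h) x = α g (α h x))
    (hcase :
      -- (1) vanishing Poincaré exponent
      ((∀ s : ℝ, {g : G | ‖α g 0‖ ^ 2 ≤ s}.Finite) ∧
        Tendsto (fun s : ℝ => Real.log ({g : G | ‖α g 0‖ ^ 2 ≤ s}.ncard) / s)
          atTop (nhds 0))
      ∨
      -- (2) almost fixed points and finite Poincaré exponent
      ((∀ (F : Finset G) (ε : ℝ), 0 < ε → ∃ x : H, ∀ g ∈ F, ‖α g x - x‖ ≤ ε) ∧
        (∀ s : ℝ, {g : G | ‖α g 0‖ ^ 2 ≤ s}.Finite) ∧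
        (∃ d : ℝ, ∀ s : ℝ, 1 ≤ s →
          Real.log ({g : G | ‖α g 0‖ ^ 2 ≤ s}.ncard) / s ≤ d))
      ∨
      -- (3) superdiffusive growth of the cocycle
      (∃ S : Finset G, (∀ g ∈ S, g⁻¹ ∈ S) ∧ Subgroup.closure (S : Set G) = ⊤ ∧
        Tendsto (fun g : G => ‖α g 0‖ / Real.sqrt (wordLength S g))
          (Filter.comap (fun g : G => wordLength S g) atTop) atTop)) :
    ∀ μ : G →₀ ℝ, (∀ g, 0 ≤ μ g) → (∑ g ∈ μ.support, μ g = 1) →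
      (∀ g, μ g⁻¹ = μ g) → Subgroup.closure (μ.support : Set G) = ⊤ →
      ∀ f : G → ℝ, (∃ C : ℝ, ∀ g, |f g| ≤ C) →
        (∀ g : G, f g = ∑ h ∈ μ.support, μ h * f (g * h)) →
        ∀ g h : G, f g = f h := by
  intro μ hμ hsum hsymm hgen f hbdd hf
  refine harmonic_const_of_entropy hμ hsum hsymm hgen (fun ε hε => ?_) hbdd hf
  have hzero : ∃ g, ‖α g 0‖ ^ 2 ≤ 0 := ⟨1, by simp [hone]⟩
  have of_forall_summable : (∀ t > 0, Summable fun g => Real.exp (-(t * ‖α g 0‖ ^ 2))) →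
      ∃ n, walkEntropy μ (n + 1) - walkEntropy μ n ≤ ε := by
    intro h
    set A := ∑ s ∈ μ.support, μ s * ‖α s 0 - 0‖ ^ 2
    have hA : 0 ≤ A := Finset.sum_nonneg fun s _ => mul_nonneg (hμ s) (sq_nonneg _)
    have ht : 0 < ε / (A + 1) := by positivity
    refine exists_entropy_increment_le_of_summable (x := (0 : H)) hμ hsum hsymm hiso hmul ht.le
      (by simpa only [sub_zero] using h _ ht) ?_
    rw [div_mul_eq_mul_div, div_lt_iff₀ (by positivity)]
    nlinarith
  rcases hcase with ⟨hfin, hlim⟩ | ⟨hfix, hfin, d, hd⟩ | ⟨S, hS, hSgen, hlim⟩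
  · refine of_forall_summable fun t ht => ?_
    exact summable_exp_neg_mul_of_sublevel_growth (half_lt_self ht) ht.le
      (fun g => sq_nonneg _) hfin hzero (hlim.eventually_le_const (half_pos ht))
  · set t := |d| + 1 with ht
    have ht0 : 0 < t := by positivity
    have hsummable : Summable fun g => Real.exp (-(t * ‖α g 0‖ ^ 2)) :=
      summable_exp_neg_mul_of_sublevel_growth (by linarith [le_abs_self d]) ht0.le
        (fun g => sq_nonneg _) hfin hzero ((eventually_ge_atTop 1).mono hd)
    set r := Real.sqrt (ε / (4 * t)) with hr
    have hr2 : r ^ 2 = ε / (4 * t) := Real.sq_sqrt (by positivity)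
    obtain ⟨x, hx⟩ := hfix μ.support r (Real.sqrt_pos.2 (by positivity))
    refine exists_entropy_increment_le_of_summable (x := x) (t := 2 * t) hμ hsum hsymm hiso hmul
      (by positivity) ?_ ?_
    · refine (hsummable.mul_left (Real.exp (2 * t * (2 * ‖x‖) ^ 2))).of_nonneg_of_le
        (fun g => (Real.exp_pos _).le) fun g => ?_
      rw [← Real.exp_add, Real.exp_le_exp]
      have h1 : ‖α g 0‖ ≤ ‖α g x - x‖ + 2 * ‖x‖ := by
        have h2 : ‖α g 0 - α g x‖ = ‖x‖ := by
          rw [← dist_eq_norm, (hiso g).dist_eq, dist_zero_left]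
        calc ‖α g 0‖ = ‖(α g 0 - α g x) + (α g x - x) + x‖ := by congr 1; abel
          _ ≤ _ := norm_add₃_le
          _ = _ := by rw [h2]; ring
      have h2 : ‖α g 0‖ ^ 2 ≤ 2 * ‖α g x - x‖ ^ 2 + 2 * (2 * ‖x‖) ^ 2 := by
        have := pow_le_pow_left₀ (norm_nonneg _) h1 2
        nlinarith [sq_nonneg (‖α g x - x‖ - 2 * ‖x‖)]
      have := mul_le_mul_of_nonneg_left h2 ht0.le
      linarith
    · have hle : ∑ s ∈ μ.support, μ s * ‖α s x - x‖ ^ 2 ≤ r ^ 2 := by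
        rw [← one_mul (r ^ 2), ← hsum, Finset.sum_mul]
        exact Finset.sum_le_sum fun s hs => mul_le_mul_of_nonneg_left
          (pow_le_pow_left₀ (norm_nonneg _) (hx s hs) 2) (hμ s)
      calc _ ≤ 2 * t * r ^ 2 := mul_le_mul_of_nonneg_left hle (by positivity)
        _ = ε / 2 := by rw [hr2]; field_simp; norm_num
        _ < ε := half_lt_self hε
  · exact of_forall_summable fun t ht => summable_exp_neg_mul_sq_of_tendsto hS hSgen hlim ht
end

section
/- Let G be a countable group acting nonsingularly on a probability space (X,μ) with Radon–Nikodym cocycle ω, and let B ⊆ A ⊆ G be finite subsets. Then ∫_X (∑_{g∈B} ω(g,x)) / (∑_{g∈A} ω(g,x)) dμ(x) ≤ ( (|B|/|A|²) · ∑_{g∈A} ∫_X ω(g,x)⁻¹ dμ(x) )^{1/2}. -/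
open MeasureTheory Filter
open scoped ENNReal

noncomputable section

/-- The Radon–Nikodym cocycle `ω(g,x) = d((g⁻¹)_*μ)/dμ (x)` of a nonsingular action. -/
def rnCocycle {G : Type*} [Group G] {X : Type*} [MeasurableSpace X]
    (μ : Measure X) (a : G → X → X) (g : G) (x : X) : ℝ≥0∞ :=
  (μ.map (a g⁻¹)).rnDeriv μ x

end

/-- The inequality between harmonic and arithmetic means, for weights in `[0, ∞]`. -/
theorem ENNReal.card_sq_div_sum_le_sum_inv {ι : Type*} (s : Finset ι) (f : ι → ℝ≥0∞) :
    (s.card : ℝ≥0∞) ^ 2 / ∑ i ∈ s, f i ≤ ∑ i ∈ s, (f i)⁻¹ := by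
  by_cases h0 : ∃ i ∈ s, f i = 0
  · obtain ⟨i, hi, h⟩ := h0
    exact le_top.trans_eq (ENNReal.sum_eq_top.2 ⟨i, hi, by simp [h]⟩).symm
  by_cases htop : ∃ i ∈ s, f i = ∞
  · rw [ENNReal.sum_eq_top.2 htop, ENNReal.div_top]
    exact zero_le
  push Not at h0 htop
  have sqrt_sq (t : ℝ≥0∞) : (t ^ (1 / 2 : ℝ)) ^ (2 : ℝ) = t := by
    rw [← ENNReal.rpow_mul]; norm_num
  have key := ENNReal.inner_le_Lp_mul_Lq s (fun i => f i ^ (1 / 2 : ℝ))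
    (fun i => (f i)⁻¹ ^ (1 / 2 : ℝ)) Real.HolderConjugate.two_two
  have hone : ∑ i ∈ s, f i ^ (1 / 2 : ℝ) * (f i)⁻¹ ^ (1 / 2 : ℝ) = s.card := by
    rw [Finset.sum_congr rfl (g := fun _ => 1) fun i hi => ?_]
    · simp
    · rw [← ENNReal.mul_rpow_of_nonneg _ _ (by norm_num),
        ENNReal.mul_inv_cancel (h0 i hi) (htop i hi), ENNReal.one_rpow]
  simp only [sqrt_sq, hone] at key
  refine ENNReal.div_le_of_le_mul' ?_
  have := ENNReal.rpow_le_rpow key (zero_le_two (α := ℝ))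
  rwa [ENNReal.mul_rpow_of_nonneg _ _ zero_le_two, sqrt_sq, sqrt_sq, ENNReal.rpow_two] at this

/-- Cauchy–Schwarz applied to `f / g = √f * (√f / g)`, when `f ≤ g`. -/
theorem lintegral_div_le_sqrt_mul_lintegral_inv {X : Type*} [MeasurableSpace X] {μ : Measure X}
    {f g : X → ℝ≥0∞} (hf : Measurable f) (hg : Measurable g) (hfg : f ≤ g) :
    ∫⁻ x, f x / g x ∂μ ≤ ((∫⁻ x, f x ∂μ) * ∫⁻ x, (g x)⁻¹ ∂μ) ^ (1 / 2 : ℝ) := by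
  have sqrt_sq (t : ℝ≥0∞) : (t ^ (1 / 2 : ℝ)) ^ (2 : ℝ) = t := by
    rw [← ENNReal.rpow_mul]; norm_num
  have key := ENNReal.lintegral_mul_le_Lp_mul_Lq μ Real.HolderConjugate.two_two
    (f := fun x => f x ^ (1 / 2 : ℝ)) (g := fun x => f x ^ (1 / 2 : ℝ) * (g x)⁻¹)
    (by fun_prop) (by fun_prop)
  simp only [Pi.mul_apply, sqrt_sq] at key
  have hmul (x : X) : f x ^ (1 / 2 : ℝ) * (f x ^ (1 / 2 : ℝ) * (g x)⁻¹) = f x / g x := by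
    rw [← mul_assoc, ← pow_two, ← ENNReal.rpow_two, sqrt_sq, div_eq_mul_inv]
  have hle (x : X) : (f x ^ (1 / 2 : ℝ) * (g x)⁻¹) ^ (2 : ℝ) ≤ (g x)⁻¹ := by
    rw [ENNReal.mul_rpow_of_nonneg _ _ zero_le_two, sqrt_sq, ENNReal.rpow_two, pow_two,
      ← mul_assoc, ← div_eq_mul_inv]
    exact mul_le_of_le_one_left' (ENNReal.div_le_of_le_mul (by simpa using hfg x))
  simp only [hmul] at key
  rw [ENNReal.mul_rpow_of_nonneg _ _ (by norm_num)]
  refine key.trans ?_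
  gcongr with x
  exact hle x

theorem measurable_rnCocycle {G : Type*} [Group G] {X : Type*} [MeasurableSpace X]
    (μ : Measure X) (a : G → X → X) (g : G) : Measurable (rnCocycle μ a g) :=
  Measure.measurable_rnDeriv _ _

theorem lintegral_rnCocycle_le_one {G : Type*} [Group G] {X : Type*} [MeasurableSpace X]
    (μ : Measure X) [IsProbabilityMeasure μ] {a : G → X → X} {g : G}
    (ha : Measurable (a g⁻¹)) : ∫⁻ x, rnCocycle μ a g x ∂μ ≤ 1 := by
  have := Measure.isProbabilityMeasure_map (μ := μ) ha.aemeasurable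
  exact Measure.lintegral_rnDeriv_le.trans prob_le_one

/-- **Lemma `lem.estim-fraction`.** Let `G` be a countable group acting
nonsingularly on a probability space `(X,μ)` with Radon–Nikodym cocycle `ω`, and let
`B ⊆ A ⊆ G` be finite subsets. Then
`∫_X (∑_{g∈B} ω(g,x)) / (∑_{g∈A} ω(g,x)) dμ(x)
  ≤ ( (|B|/|A|²) ∑_{g∈A} ∫_X ω(g,x)⁻¹ dμ(x) )^{1/2}`. -/
theorem integral_ratio_le_sqrt
    {G : Type*} [Group G] [Countable G]
    {X : Type*} [MeasurableSpace X] (μ : Measure X) [IsProbabilityMeasure μ]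
    (a : G → X → X) (ha_meas : ∀ g, Measurable (a g))
    (ha_one : ∀ x, a 1 x = x) (ha_mul : ∀ g h x, a (g * h) x = a g (a h x))
    (ha_ns : ∀ g, μ.map (a g) ≪ μ ∧ μ ≪ μ.map (a g))
    (A B : Finset G) (hBA : B ⊆ A) :
    ∫⁻ x, (∑ g ∈ B, rnCocycle μ a g x) / (∑ g ∈ A, rnCocycle μ a g x) ∂μ
      ≤ ((B.card : ℝ≥0∞) / (A.card : ℝ≥0∞) ^ 2 *
          ∑ g ∈ A, ∫⁻ x, (rnCocycle μ a g x)⁻¹ ∂μ) ^ (1 / 2 : ℝ) := by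
  have hm := measurable_rnCocycle μ a
  rcases A.eq_empty_or_nonempty with rfl | hA
  · simp [Finset.subset_empty.1 hBA]
  have hcard : (A.card : ℝ≥0∞) ^ 2 ≠ 0 := by simpa using hA.ne_empty
  refine (lintegral_div_le_sqrt_mul_lintegral_inv
    (Finset.measurable_fun_sum B fun g _ => hm g) (Finset.measurable_fun_sum A fun g _ => hm g)
    fun x => Finset.sum_le_sum_of_subset hBA).trans ?_
  refine ENNReal.rpow_le_rpow ?_ (by norm_num)
  have hB : ∫⁻ x, ∑ g ∈ B, rnCocycle μ a g x ∂μ ≤ B.card := by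
    rw [lintegral_finsetSum _ fun g _ => hm g]
    simpa using Finset.sum_le_card_nsmul B _ 1
      fun g _ => lintegral_rnCocycle_le_one μ (ha_meas g⁻¹)
  have hinv : ∫⁻ x, (∑ g ∈ A, rnCocycle μ a g x)⁻¹ ∂μ
      ≤ ((A.card : ℝ≥0∞) ^ 2)⁻¹ * ∑ g ∈ A, ∫⁻ x, (rnCocycle μ a g x)⁻¹ ∂μ := by
    have hm_inv (g : G) : Measurable fun x => (rnCocycle μ a g x)⁻¹ := (hm g).inv
    rw [← lintegral_finsetSum _ fun g _ => hm_inv g,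
      ← lintegral_const_mul _ (Finset.measurable_fun_sum A fun g _ => hm_inv g)]
    refine lintegral_mono fun x => ?_
    rw [← ENNReal.mul_le_iff_le_inv hcard (by finiteness), ← div_eq_mul_inv]
    exact ENNReal.card_sq_div_sum_le_sum_inv A _
  rw [div_eq_mul_inv, mul_assoc]
  exact mul_le_mul' hB hinv
end

section
/- Let H be a real Hilbert space, I a nonempty index set, (H_i)_{i∈I} closed linear subspaces of H, and ξ_i ∈ H_i^⊥ for every i ∈ I. Set K = ⋂_{i∈I} H_i and M = ⋂_{i∈I} (ξ_i + H_i), and let T ⊆ H × ℝ (with the Hilbert space direct sum inner product) be the closed linear span of all vectors (η, -⟨η, ξ_i⟩) with i ∈ I and η ∈ H_i^⊥. Then: (1) if M = ∅, then T = K^⊥ × ℝ; (2) if ζ ∈ M, then M = ζ + K and T = {(η, -⟨η, ζ⟩) : η ∈ K^⊥}. -/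
open scoped RealInnerProductSpace

/-- A point lies in the closed linear span of `S` iff every continuous linear functional that
vanishes on `S` vanishes at it. -/
theorem mem_topologicalClosure_span_iff_forall_dual {E : Type*} [NormedAddCommGroup E]
    [NormedSpace ℝ E] (S : Set E) (v : E) :
    v ∈ (Submodule.span ℝ S).topologicalClosure ↔
      ∀ f : StrongDual ℝ E, (∀ s ∈ S, f s = 0) → f v = 0 := by
  constructor
  · intro hv f hf
    have hle : (Submodule.span ℝ S).topologicalClosure ≤ LinearMap.ker (f : E →ₗ[ℝ] ℝ) :=
      Submodule.topologicalClosure_minimal _ (Submodule.span_le.2 hf) f.isClosed_ker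
    exact hle hv
  · intro h
    by_contra hv
    obtain ⟨f, u, hfu, huv⟩ := geometric_hahn_banach_closed_point
      (Submodule.convex _) (Submodule.isClosed_topologicalClosure _) hv
    have hu : 0 < u := by simpa using hfu 0 (Submodule.zero_mem _)
    refine (hu.trans huv).ne' (h f fun s hs => ?_)
    by_contra hne
    have hmem := Submodule.smul_mem _ (u / f s)
      (Submodule.le_topologicalClosure _ (Submodule.subset_span hs))
    have := hfu _ hmem
    rw [map_smul, smul_eq_mul, div_mul_cancel₀ _ hne] at this
    exact this.false

/-- A point lies in the closed span of the vectors `(η, -⟪η, ξ i⟫)`, `η ∈ (Hs i)ᗮ`, iff it is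
annihilated by every pair `(a, b)` with `a - b • ξ i ∈ Hs i` for all `i`. -/
theorem mem_topologicalClosure_span_graph_iff
    {H : Type*} [NormedAddCommGroup H] [InnerProductSpace ℝ H] [CompleteSpace H] {I : Type*}
    (Hs : I → Submodule ℝ H) (hHs : ∀ i, IsClosed (Hs i : Set H)) (ξ : I → H) (v : H × ℝ) :
    v ∈ (Submodule.span ℝ
        {v : H × ℝ | ∃ i, ∃ η ∈ (Hs i)ᗮ, v = (η, -⟪η, ξ i⟫)}).topologicalClosure ↔
      ∀ (a : H) (b : ℝ), (∀ i, a - b • ξ i ∈ Hs i) → ⟪v.1, a⟫ + b * v.2 = 0 := by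
  rw [mem_topologicalClosure_span_iff_forall_dual]
  constructor
  · intro h a b hab
    have hv := h ((innerSL ℝ a).coprod (b • ContinuousLinearMap.id ℝ ℝ)) ?_
    · simpa [real_inner_comm] using hv
    · rintro _ ⟨i, η, hη, rfl⟩
      have := Submodule.inner_left_of_mem_orthogonal (hab i) hη
      rw [inner_sub_right, inner_smul_right] at this
      simpa [real_inner_comm, sub_eq_add_neg] using this
  · intro h f hf
    let a : H := (InnerProductSpace.toDual ℝ H).symm (f.comp (.inl ℝ H ℝ))
    let b : ℝ := f (0, 1)
    have hfab (w : H × ℝ) : f w = ⟪w.1, a⟫ + b * w.2 := by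
      have hw : w = (w.1, 0) + w.2 • ((0, 1) : H × ℝ) := by simp
      rw [real_inner_comm, InnerProductSpace.toDual_symm_apply, mul_comm b]
      conv_lhs => rw [hw, map_add, map_smul]
      rfl
    rw [hfab]
    refine h a b fun i => ?_
    have : CompleteSpace (Hs i) := (hHs i).completeSpace_coe
    rw [← (Hs i).orthogonal_orthogonal, Submodule.mem_orthogonal]
    intro η hη
    have := hf _ ⟨i, η, hη, rfl⟩
    rw [hfab] at this
    rw [inner_sub_right, inner_smul_right]
    linarith

/-- **Proposition `prop.intersection spaces`, Hilbert-geometric content.**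
Let `H` be a real Hilbert space, `(H_i)_{i∈I}` closed linear subspaces (`I ≠ ∅`) and
`ξ_i ∈ H_i^⊥`. Set `K = ⋂ᵢ H_i`, `M = ⋂ᵢ (ξ_i + H_i)`, and let `T ⊆ H × ℝ` be the closed
linear span of the vectors `(η, -⟨η,ξ_i⟩)` with `i ∈ I`, `η ∈ H_i^⊥`. Then:
(1) if `M = ∅`, then `T = K^⊥ × ℝ`;
(2) if `ζ ∈ M`, then `M = ζ + K` and `T = {(η, -⟨η,ζ⟩) : η ∈ K^⊥}`. -/
theorem closed_span_of_affine_intersections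
    {H : Type*} [NormedAddCommGroup H] [InnerProductSpace ℝ H] [CompleteSpace H]
    {I : Type*} [Nonempty I]
    (Hs : I → Submodule ℝ H) (hHs : ∀ i, IsClosed ((Hs i : Submodule ℝ H) : Set H))
    (ξ : I → H) (hξ : ∀ i, ξ i ∈ (Hs i)ᗮ)
    (K : Submodule ℝ H) (hK : K = ⨅ i, Hs i)
    (M : Set H) (hM : M = ⋂ i, {x : H | x - ξ i ∈ Hs i})
    (T : Submodule ℝ (H × ℝ))
    (hT : T = (Submodule.span ℝ
        {v : H × ℝ | ∃ i, ∃ η ∈ (Hs i)ᗮ, v = (η, -⟪η, ξ i⟫)}).topologicalClosure) :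
    (M = ∅ → (T : Set (H × ℝ)) = ((Kᗮ : Submodule ℝ H) : Set H) ×ˢ (Set.univ : Set ℝ)) ∧
    (∀ ζ ∈ M, M = {x : H | x - ζ ∈ K} ∧
      (T : Set (H × ℝ)) = {v : H × ℝ | v.1 ∈ Kᗮ ∧ v.2 = -⟪v.1, ζ⟫}) := by
  subst hK hM hT
  have hmem := mem_topologicalClosure_span_graph_iff Hs hHs ξ
  refine ⟨fun hempty => ?_, fun ζ hζ => ?_⟩
  · ext v
    rw [SetLike.mem_coe, hmem]
    simp only [Set.mem_prod, SetLike.mem_coe, Set.mem_univ, and_true,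
      Submodule.mem_orthogonal', Submodule.mem_iInf]
    refine ⟨fun h a ha => by simpa using h a 0 (by simpa using ha), fun h a b hab => ?_⟩
    obtain rfl : b = 0 := by
      by_contra hb
      refine Set.eq_empty_iff_forall_notMem.1 hempty (b⁻¹ • a) (Set.mem_iInter.2 fun i => ?_)
      simpa [smul_sub, smul_smul, hb] using (Hs i).smul_mem b⁻¹ (hab i)
    simpa using h a (by simpa using hab)
  · have hζ' (i : I) : ζ - ξ i ∈ Hs i := Set.mem_iInter.1 hζ i
    have hshift (a : H) (b : ℝ) (i : I) : a - b • ξ i ∈ Hs i ↔ a - b • ζ ∈ Hs i := by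
      rw [← Submodule.add_mem_iff_left (Hs i) ((Hs i).smul_mem b (hζ' i)) (x := a - b • ζ)]
      simp [smul_sub]
    constructor
    · ext x
      simpa [Submodule.mem_iInf] using forall_congr' (hshift x 1)
    · ext v
      rw [SetLike.mem_coe, hmem]
      simp only [hshift, Set.mem_ofPred_eq, Submodule.mem_orthogonal',
        Submodule.mem_iInf]
      constructor
      · intro h
        refine ⟨fun a ha => by simpa using h a 0 (by simpa using ha), ?_⟩
        have := h ζ 1 (by simp)
        linarith
      · rintro ⟨hK, hv⟩ a b hab
        have := hK _ hab
        rw [inner_sub_right, inner_smul_right] at this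
        rw [hv]
        linarith
end

section
/- Let H be a real Hilbert space, P : H → H a continuous linear operator with ‖P‖ ≤ 1 that is positive (self-adjoint with ⟨Px, x⟩ ≥ 0 for all x), and ξ ∈ H. Define the affine contraction T : H → H by T(x) = Px + ξ. Then T has a fixed point if and only if the sequence (‖Tⁿ(0)‖)_{n∈ℕ} is bounded. -/
open scoped RealInnerProductSpace

section

variable {H : Type*} [NormedAddCommGroup H] [InnerProductSpace ℝ H]

theorem inner_pow_apply_self_nonneg (P : H →L[ℝ] H)
    (hPsa : ∀ x y : H, ⟪P x, y⟫ = ⟪x, P y⟫) (hPpos : ∀ x : H, 0 ≤ ⟪P x, x⟫) (n : ℕ) (x : H) :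
    0 ≤ ⟪(P ^ n) x, x⟫ := by
  induction n using Nat.twoStepInduction generalizing x with
  | zero => simp
  | one => simpa using hPpos x
  | more n ih _ =>
    have h : (P ^ (n + 2)) x = P ((P ^ n) (P x)) := by
      rw [pow_succ, pow_succ']; rfl
    rw [h, hPsa]
    exact ih (P x)

theorem inner_pow_apply_pow_apply_nonneg (P : H →L[ℝ] H)
    (hPsa : ∀ x y : H, ⟪P x, y⟫ = ⟪x, P y⟫) (hPpos : ∀ x : H, 0 ≤ ⟪P x, x⟫) (i j : ℕ) (x : H) :
    0 ≤ ⟪(P ^ i) x, (P ^ j) x⟫ := by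
  induction j generalizing i with
  | zero => simpa using inner_pow_apply_self_nonneg P hPsa hPpos i x
  | succ j ih =>
    have h := ih (i + 1)
    rw [pow_succ', mul_apply_eq_comp, hPsa] at h
    rwa [pow_succ', mul_apply_eq_comp]

theorem iterate_affine_zero_eq_sum (P : H →L[ℝ] H) (ξ : H) (n : ℕ) :
    (fun x : H => P x + ξ)^[n] 0 = ∑ k ∈ Finset.range n, (P ^ k) ξ := by
  induction n with
  | zero => simp
  | succ n ih =>
    rw [Function.iterate_succ_apply', ih, Finset.sum_range_succ', map_sum]
    simp [pow_succ']

/-- A bounded sequence in which each term makes a non-obtuse angle with all later increments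
is Cauchy. -/
theorem cauchySeq_of_bounded_of_inner_sub_nonneg {s : ℕ → H} {C : ℝ} (hC : ∀ n, ‖s n‖ ≤ C)
    (hs : ∀ m n, m ≤ n → 0 ≤ ⟪s m, s n - s m⟫) : CauchySeq s := by
  have key : ∀ m n, m ≤ n → ‖s n - s m‖ ^ 2 ≤ ‖s n‖ ^ 2 - ‖s m‖ ^ 2 := fun m n hmn => by
    have h := norm_add_sq_real (s m) (s n - s m)
    rw [add_sub_cancel] at h
    linarith [hs m n hmn]
  have hmono : Monotone fun n => ‖s n‖ ^ 2 := fun m n hmn => by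
    have := key m n hmn
    have := sq_nonneg ‖s n - s m‖
    dsimp only
    linarith
  have hbdd : BddAbove (Set.range fun n => ‖s n‖ ^ 2) := by
    refine ⟨C ^ 2, ?_⟩
    rintro _ ⟨n, rfl⟩
    exact pow_le_pow_left₀ (norm_nonneg _) (hC n) 2
  have hcauchy := (tendsto_atTop_ciSup hmono hbdd).cauchySeq
  rw [Metric.cauchySeq_iff'] at hcauchy ⊢
  intro ε hε
  obtain ⟨N, hN⟩ := hcauchy (ε ^ 2) (by positivity)
  refine ⟨N, fun n hn => ?_⟩
  have h := hN n hn
  rw [Real.dist_eq] at h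
  rw [dist_eq_norm]
  exact lt_of_pow_lt_pow_left₀ 2 hε.le (((key N n hn).trans (le_abs_self _)).trans_lt h)

end

/-- **Lemma `fixed point contraction`.** Let `H` be a real Hilbert space,
`P : H → H` a positive linear contraction and `ξ ∈ H`. The affine contraction
`T(x) = Px + ξ` has a fixed point if and only if the sequence `(‖Tⁿ(0)‖)ₙ` is bounded. -/
theorem affine_contraction_fixed_point_iff_bounded_orbit
    {H : Type*} [NormedAddCommGroup H] [InnerProductSpace ℝ H] [CompleteSpace H]
    (P : H →L[ℝ] H) (hPnorm : ‖P‖ ≤ 1)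
    (hPsa : ∀ x y : H, ⟪P x, y⟫ = ⟪x, P y⟫)
    (hPpos : ∀ x : H, 0 ≤ ⟪P x, x⟫)
    (ξ : H) :
    (∃ x : H, P x + ξ = x) ↔
      ∃ C : ℝ, ∀ n : ℕ, ‖(fun x : H => P x + ξ)^[n] 0‖ ≤ C := by
  constructor
  · rintro ⟨x, hx⟩
    refine ⟨‖x‖ + ‖x‖, fun n => ?_⟩
    have hdist : ‖(fun x : H => P x + ξ)^[n] 0 - x‖ ≤ ‖x‖ := by
      induction n with
      | zero => simp
      | succ n ih =>
        rw [Function.iterate_succ_apply']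
        set y := (fun x : H => P x + ξ)^[n] 0
        calc ‖P y + ξ - x‖ = ‖P (y - x)‖ := by
              rw [map_sub]
              nth_rewrite 1 [← hx]
              rw [add_sub_add_right_eq_sub]
          _ ≤ 1 * ‖y - x‖ := P.le_of_opNorm_le hPnorm _
          _ ≤ ‖x‖ := by rwa [one_mul]
    exact (norm_le_norm_sub_add _ x).trans (by gcongr)
  · rintro ⟨C, hC⟩
    have hcauchy : CauchySeq fun n => (fun x : H => P x + ξ)^[n] 0 := by
      refine cauchySeq_of_bounded_of_inner_sub_nonneg hC fun m n hmn => ?_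
      rw [iterate_affine_zero_eq_sum, iterate_affine_zero_eq_sum,
        ← Finset.sum_Ico_eq_sub _ hmn, sum_inner]
      refine Finset.sum_nonneg fun i _ => ?_
      rw [inner_sum]
      exact Finset.sum_nonneg fun j _ => inner_pow_apply_pow_apply_nonneg P hPsa hPpos i j ξ
    obtain ⟨x, hx⟩ := cauchySeq_tendsto_of_complete hcauchy
    exact ⟨x, isFixedPt_of_tendsto_iterate hx (by fun_prop)⟩
end

section
/- Let r > 0 and let γ_r be the Gaussian probability measure on ℝ with mean r²/2 and variance r². For bounded measurable f : ℝ → ℝ define Φ_r(f)(x) = ∫_ℝ f(x - t) dγ_r(t). If f ∈ L^∞(ℝ) is such that Φ_r(f) is almost everywhere equal to a constant, or such that f = Φ_r(f) almost everywhere, then f is almost everywhere equal to a constant. -/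
open MeasureTheory ProbabilityTheory
open scoped NNReal

theorem ext_of_mgf_id_eq {μ ν : Measure ℝ} [IsFiniteMeasure μ] [IsFiniteMeasure ν]
    (hint : ∀ t, Integrable (fun x ↦ Real.exp (t * x)) μ) (h : mgf id μ = mgf id ν) : μ = ν := by
  have huniv : integrableExpSet id μ = Set.univ := Set.eq_univ_of_forall hint
  have hzero : μ = 0 ↔ ν = 0 := by
    have h0 := congrFun h 0
    simp only [mgf_zero'] at h0
    rw [← Measure.measure_univ_eq_zero, ← Measure.measure_univ_eq_zero (μ := ν),
      ← measureReal_eq_zero_iff, ← measureReal_eq_zero_iff, h0]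
  refine Measure.ext_of_complexMGF_id_eq (funext fun z ↦ ?_)
  exact eqOn_complexMGF_of_mgf' h hzero (by simp [huniv])

theorem integral_comp_sub_gaussianReal (m : ℝ) {v : ℝ≥0} (hv : v ≠ 0) (g : ℝ → ℝ) (x : ℝ) :
    ∫ t, g (x - t) ∂gaussianReal m v =
      Real.exp (x * m / v - x ^ 2 / (2 * v)) *
        ∫ s, g s * Real.exp (x / v * s) ∂gaussianReal (-m) v := by
  have hv' : (v : ℝ) ≠ 0 := by exact_mod_cast hv
  rw [integral_gaussianReal_eq_integral_smul hv, integral_gaussianReal_eq_integral_smul hv,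
    ← integral_sub_left_eq_self _ volume x, ← integral_const_mul]
  refine integral_congr_ae (.of_forall fun s ↦ ?_)
  have hexp : Real.exp (-(x - s - m) ^ 2 / (2 * v)) =
      Real.exp (x * m / v - x ^ 2 / (2 * v)) *
        (Real.exp (-(s - -m) ^ 2 / (2 * v)) * Real.exp (x / v * s)) := by
    rw [← Real.exp_add, ← Real.exp_add]
    congr 1
    field_simp
    ring
  simp only [gaussianPDFReal, smul_eq_mul, sub_sub_cancel, hexp]
  ring

theorem mgf_id_withDensity_ofReal {ρ : Measure ℝ} {g : ℝ → ℝ} (hg : Measurable g) (hg0 : 0 ≤ g)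
    (t : ℝ) :
    mgf id (ρ.withDensity fun s ↦ ENNReal.ofReal (g s)) t = ∫ s, g s * Real.exp (t * s) ∂ρ := by
  rw [mgf, integral_withDensity_eq_integral_toReal_smul (by fun_prop) (by simp)]
  simp [ENNReal.toReal_ofReal (hg0 _)]

theorem integrable_exp_mul_withDensity_ofReal {ρ : Measure ℝ} {g : ℝ → ℝ} {C : ℝ}
    (hg : Measurable g) (hg0 : 0 ≤ g) (hgC : ∀ x, g x ≤ C) {t : ℝ}
    (ht : Integrable (fun s ↦ Real.exp (t * s)) ρ) :
    Integrable (fun s ↦ Real.exp (t * s)) (ρ.withDensity fun s ↦ ENNReal.ofReal (g s)) := by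
  rw [integrable_withDensity_iff (by fun_prop) (by simp)]
  simp only [ENNReal.toReal_ofReal (hg0 _)]
  refine ht.mul_bdd (c := C) hg.aestronglyMeasurable (.of_forall fun s ↦ ?_)
  rw [Real.norm_of_nonneg (hg0 s)]
  exact hgC s

/-- Gaussian convolution is injective on nonnegative bounded functions. -/
theorem ae_eq_of_gaussian_convolution_ae_eq {m : ℝ} {v : ℝ≥0} (hv : v ≠ 0) {f g : ℝ → ℝ} {C D : ℝ}
    (hf : Measurable f) (hf0 : 0 ≤ f) (hfC : ∀ x, f x ≤ C)
    (hg : Measurable g) (hg0 : 0 ≤ g) (hgD : ∀ x, g x ≤ D)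
    (h : ∀ᵐ x, ∫ t, f (x - t) ∂gaussianReal m v = ∫ t, g (x - t) ∂gaussianReal m v) :
    f =ᵐ[volume] g := by
  have hv' : (v : ℝ) ≠ 0 := by exact_mod_cast hv
  let ρ := gaussianReal (-m) v
  let μ := ρ.withDensity fun s ↦ ENNReal.ofReal (f s)
  let ν := ρ.withDensity fun s ↦ ENNReal.ofReal (g s)
  have hμ : ∀ t, Integrable (fun s ↦ Real.exp (t * s)) μ := fun t ↦
    integrable_exp_mul_withDensity_ofReal hf hf0 hfC (integrable_exp_mul_gaussianReal t)
  have hν : ∀ t, Integrable (fun s ↦ Real.exp (t * s)) ν := fun t ↦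
    integrable_exp_mul_withDensity_ofReal hg hg0 hgD (integrable_exp_mul_gaussianReal t)
  have : IsFiniteMeasure μ := integrable_const_iff_isFiniteMeasure (one_ne_zero (α := ℝ)) |>.1
    (by simpa using hμ 0)
  have : IsFiniteMeasure ν := integrable_const_iff_isFiniteMeasure (one_ne_zero (α := ℝ)) |>.1
    (by simpa using hν 0)
  have hscaled : (fun x ↦ mgf id μ (x / v)) = fun x ↦ mgf id ν (x / v) := by
    refine Continuous.ae_eq_iff_eq (μ := volume) ((continuous_mgf hμ).comp (by fun_prop))
      ((continuous_mgf hν).comp (by fun_prop)) |>.1 ?_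
    filter_upwards [h] with x hx
    rw [integral_comp_sub_gaussianReal m hv, integral_comp_sub_gaussianReal m hv] at hx
    change mgf id μ (x / v) = mgf id ν (x / v)
    rw [mgf_id_withDensity_ofReal hf hf0, mgf_id_withDensity_ofReal hg hg0]
    exact mul_left_cancel₀ (Real.exp_ne_zero _) hx
  have hmgf : mgf id μ = mgf id ν := funext fun t ↦ by
    simpa [hv'] using congrFun hscaled (t * v)
  have hdens := (withDensity_eq_iff_of_sigmaFinite (by fun_prop) (by fun_prop)).1
    (ext_of_mgf_id_eq hμ hmgf)
  filter_upwards [gaussianReal_absolutelyContinuous' (-m) hv |>.ae_le hdens] with s hs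
  exact (ENNReal.ofReal_eq_ofReal_iff (hf0 s) (hg0 s)).1 hs

theorem ae_const_of_forall_ae_add_eq {f : ℝ → ℝ} (hf : Measurable f)
    (h : ∀ a, ∀ᵐ x, f (x + a) = f x) : ∃ c, ∀ᵐ x, f x = c := by
  have hswap : ∀ᵐ x : ℝ, ∀ᵐ a : ℝ, f (x + a) = f x :=
    (Measure.ae_ae_comm (p := fun a x ↦ f (x + a) = f x)
      (measurableSet_eq_fun (by fun_prop) (by fun_prop))).1 (.of_forall h)
  obtain ⟨x, hx⟩ := hswap.exists
  refine ⟨f x, ?_⟩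
  filter_upwards [(measurePreserving_sub_right volume x).quasiMeasurePreserving.ae hx] with y hy
  simpa using hy

theorem ae_eq_integral_gaussianReal_nsmul {m : ℝ} {v : ℝ≥0} (hv : v ≠ 0) {f : ℝ → ℝ} {C : ℝ}
    (hf : Measurable f) (hfC : ∀ x, |f x| ≤ C)
    (h : ∀ᵐ x, f x = ∫ t, f (x - t) ∂gaussianReal m v) (n : ℕ) :
    ∀ᵐ x, f x = ∫ t, f (x - t) ∂gaussianReal (n * m) (n * v) := by
  induction n with
  | zero => simp
  | succ n ih =>
    filter_upwards [ih, h] with x hx hx0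
    rcases eq_or_ne n 0 with rfl | hn
    · simpa using hx0
    have hac : gaussianReal (n * m) (n * v) ≪ volume :=
      gaussianReal_absolutelyContinuous _ (by simp [hn, hv])
    rw [show ((n + 1 : ℕ) : ℝ) * m = n * m + m by push_cast; ring,
      show ((n + 1 : ℕ) : ℝ≥0) * v = n * v + v by push_cast; ring,
      ← gaussianReal_conv_gaussianReal, integral_conv, hx]
    · refine integral_congr_ae ?_
      filter_upwards [hac.ae_le
        ((Measure.measurePreserving_sub_left volume x).quasiMeasurePreserving.ae h)] with s hs
      have hs' : f (x - s) = ∫ t, f (x - s - t) ∂gaussianReal m v := hs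
      simpa only [sub_sub] using hs'
    · exact .of_bound (Measurable.aestronglyMeasurable (by fun_prop)) C (.of_forall fun s ↦ hfC _)

theorem tendsto_integral_abs_gaussianPDFReal_add_sub (v : ℝ≥0) :
    Filter.Tendsto (fun a ↦ ∫ w, |gaussianPDFReal 0 v (w + a) - gaussianPDFReal 0 v w|)
      (nhds 0) (nhds 0) := by
  rcases eq_or_ne v 0 with rfl | hv
  · simp
  have hv' : (0 : ℝ) < v := by positivity
  have hlim : Filter.Tendsto
      (fun a ↦ ∫ w, |gaussianPDFReal 0 v (w + a) - gaussianPDFReal 0 v w|)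
      (nhds 0) (nhds (∫ _ : ℝ, (0 : ℝ))) := by
    refine tendsto_integral_filter_of_dominated_convergence
      (fun w ↦ (√(2 * Real.pi * v))⁻¹ * (Real.exp (1 / (2 * v)) * Real.exp (-(1 / (4 * v)) * w ^ 2))
        + gaussianPDFReal 0 v w)
      (.of_forall fun a ↦ by fun_prop) ?_ ?_ ?_
    · filter_upwards [Metric.ball_mem_nhds (0 : ℝ) one_pos] with a ha
      refine .of_forall fun w ↦ ?_
      have ha1 : a ^ 2 ≤ 1 := by
        rw [mem_ball_zero_iff, Real.norm_eq_abs] at ha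
        exact (sq_le_one_iff_abs_le_one a).2 ha.le
      have hshift : gaussianPDFReal 0 v (w + a) ≤
          (√(2 * Real.pi * v))⁻¹ * (Real.exp (1 / (2 * v)) * Real.exp (-(1 / (4 * v)) * w ^ 2)) := by
        rw [gaussianPDFReal, ← Real.exp_add]
        gcongr
        rw [← sub_nonneg]
        have : 1 / (2 * v) + -(1 / (4 * v)) * w ^ 2 - -(w + a - 0) ^ 2 / (2 * v) =
          (2 - w ^ 2 + 2 * (w + a) ^ 2) / (4 * (v : ℝ)) := by
            field_simp
            ring
        rw [this]
        refine div_nonneg ?_ (by positivity)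
        nlinarith [sq_nonneg (w + 2 * a)]
      rw [Real.norm_eq_abs, abs_abs]
      refine (abs_sub _ _).trans ?_
      rw [abs_of_nonneg (gaussianPDFReal_nonneg _ _ _), abs_of_nonneg (gaussianPDFReal_nonneg _ _ _)]
      gcongr
    · exact (((integrable_exp_neg_mul_sq (by positivity)).const_mul _).const_mul _).add
        (integrable_gaussianPDFReal 0 v)
    · refine .of_forall fun w ↦ ?_
      have hcont : Continuous fun a ↦ |gaussianPDFReal 0 v (w + a) - gaussianPDFReal 0 v w| := by
        unfold gaussianPDFReal
        fun_prop
      simpa using hcont.tendsto 0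
  simpa using hlim

theorem abs_integral_gaussianReal_shift_le {v : ℝ≥0} (hv : v ≠ 0) {g : ℝ → ℝ} {C : ℝ}
    (hg : Measurable g) (hgC : ∀ x, |g x| ≤ C) (a : ℝ) :
    |(∫ w, g (w - a) ∂gaussianReal 0 v) - ∫ w, g w ∂gaussianReal 0 v| ≤
      C * ∫ w, |gaussianPDFReal 0 v (w + a) - gaussianPDFReal 0 v w| := by
  have hint := integrable_gaussianPDFReal 0 v
  have hbdd {p : ℝ → ℝ} (hp : Integrable p) : Integrable fun w ↦ p w * g w :=
    hp.mul_bdd (c := C) hg.aestronglyMeasurable (.of_forall hgC)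
  rw [integral_gaussianReal_eq_integral_smul hv, integral_gaussianReal_eq_integral_smul hv,
    ← integral_add_right_eq_self _ a]
  simp only [add_sub_cancel_right, smul_eq_mul]
  rw [← integral_sub (hbdd (hint.comp_add_right a)) (hbdd hint), ← integral_const_mul]
  refine abs_integral_le_integral_abs.trans
    (integral_mono (((hbdd (hint.comp_add_right a)).sub (hbdd hint)).abs)
      (((hint.comp_add_right a).sub hint).abs.const_mul C) fun w ↦ ?_)
  simp only [← sub_mul, abs_mul]
  rw [mul_comm]
  gcongr
  exact hgC w

theorem gaussianReal_sq_mul_eq_map (m : ℝ) (v : ℝ≥0) (k : ℕ) :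
    gaussianReal m ((k ^ 2 : ℕ) * v) = (gaussianReal 0 v).map fun w ↦ m + k * w := by
  rw [show (fun w : ℝ ↦ m + k * w) = (m + ·) ∘ (k * ·) from rfl,
    ← Measure.map_map (by fun_prop) (by fun_prop), gaussianReal_map_const_mul,
    gaussianReal_map_const_add]
  congr 1
  · simp
  · congr 1
    ext
    simp

/-- Bounded functions fixed by convolution with a nondegenerate Gaussian are constant. -/
theorem ae_const_of_ae_eq_gaussian_convolution {m : ℝ} {v : ℝ≥0} (hv : v ≠ 0) {f : ℝ → ℝ} {C : ℝ}
    (hf : Measurable f) (hfC : ∀ x, |f x| ≤ C)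
    (h : ∀ᵐ x, f x = ∫ t, f (x - t) ∂gaussianReal m v) : ∃ c, ∀ᵐ x, f x = c := by
  refine ae_const_of_forall_ae_add_eq hf fun a ↦ ?_
  have hfix : ∀ᵐ x, ∀ n : ℕ, f x = ∫ t, f (x - t) ∂gaussianReal (n * m) (n * v) :=
    ae_all_iff.2 (ae_eq_integral_gaussianReal_nsmul hv hf hfC h)
  filter_upwards [hfix,
    (measurePreserving_add_right volume a).quasiMeasurePreserving.ae hfix] with x hx hxa
  have hle (k : ℕ) : |f (x + a) - f x| ≤
      C * ∫ w, |gaussianPDFReal 0 v (w + a / (k + 1 : ℕ)) - gaussianPDFReal 0 v w| := by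
    have hk : ((k + 1 : ℕ) : ℝ) ≠ 0 := by positivity
    have hrescale (y : ℝ) : ∫ t, f (y - t) ∂gaussianReal (((k + 1) ^ 2 : ℕ) * m)
        (((k + 1) ^ 2 : ℕ) * v) =
        ∫ w, f (y - (((k + 1) ^ 2 : ℕ) * m + (k + 1 : ℕ) * w)) ∂gaussianReal 0 v := by
      rw [gaussianReal_sq_mul_eq_map, integral_map (by fun_prop)
        (Measurable.aestronglyMeasurable (by fun_prop))]
    rw [hx ((k + 1) ^ 2), hxa ((k + 1) ^ 2), hrescale, hrescale]
    convert abs_integral_gaussianReal_shift_le hv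
      (g := fun w ↦ f (x - (((k + 1) ^ 2 : ℕ) * m + (k + 1 : ℕ) * w))) (by fun_prop)
      (fun w ↦ hfC _) (a / (k + 1 : ℕ)) using 6
    field_simp
    ring
  have hlim : Filter.Tendsto (fun k : ℕ ↦
      C * ∫ w, |gaussianPDFReal 0 v (w + a / (k + 1 : ℕ)) - gaussianPDFReal 0 v w|)
      Filter.atTop (nhds 0) := by
    have hscale : Filter.Tendsto (fun k : ℕ ↦ a / (k + 1 : ℕ)) Filter.atTop (nhds 0) :=
      (tendsto_const_div_atTop_nhds_zero_nat a).comp (Filter.tendsto_add_atTop_nat 1)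
    simpa using ((tendsto_integral_abs_gaussianPDFReal_add_sub v).comp hscale).const_mul C
  exact sub_eq_zero.1 (abs_nonpos_iff.1 (ge_of_tendsto' hlim hle))

/-- **Lemma `convolution constant`.** Let `r > 0` and let `Φ_r` denote
convolution with the Gaussian distribution `γ_r` of mean `r²/2` and variance `r²`, i.e.
`Φ_r(f)(x) = ∫ f(x - t) dγ_r(t)`. If `f ∈ L^∞(ℝ)` is such that `Φ_r(f)` is a.e. constant,
or such that `f = Φ_r(f)` a.e., then `f` is a.e. constant. -/
theorem constant_of_gaussian_convolution
    (r : ℝ) (hr : 0 < r)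
    (f : ℝ → ℝ) (hf_meas : Measurable f) (hf_bdd : ∃ C : ℝ, ∀ x, |f x| ≤ C)
    (h : (∃ cst : ℝ, ∀ᵐ x ∂(volume : Measure ℝ),
            (∫ t, f (x - t) ∂(gaussianReal (r ^ 2 / 2) (r ^ 2).toNNReal)) = cst) ∨
         (∀ᵐ x ∂(volume : Measure ℝ),
            f x = ∫ t, f (x - t) ∂(gaussianReal (r ^ 2 / 2) (r ^ 2).toNNReal))) :
    ∃ cst : ℝ, ∀ᵐ x ∂(volume : Measure ℝ), f x = cst := by
  have hv : (r ^ 2).toNNReal ≠ 0 := by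
    rw [Ne, Real.toNNReal_eq_zero, not_le]
    positivity
  obtain ⟨C, hC⟩ := hf_bdd
  rcases h with ⟨c, hc⟩ | h
  · have hf0 : 0 ≤ fun x ↦ f x + C := fun x ↦ by
      have := neg_le_of_abs_le (hC x)
      simp only [Pi.zero_apply]
      linarith
    have hshift : ∀ᵐ x, ∫ t, (f (x - t) + C) ∂gaussianReal (r ^ 2 / 2) (r ^ 2).toNNReal
        = c + C := by
      filter_upwards [hc] with x hx
      rw [integral_add (.of_bound (Measurable.aestronglyMeasurable (by fun_prop)) C
        (.of_forall fun s ↦ hC _)) (integrable_const C), hx]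
      simp
    obtain ⟨x, hx⟩ := hshift.exists
    have hcC : 0 ≤ c + C := hx ▸ integral_nonneg fun t ↦ hf0 (x - t)
    have hae := ae_eq_of_gaussian_convolution_ae_eq (m := r ^ 2 / 2) hv
      (f := fun x ↦ f x + C) (g := fun _ ↦ c + C) (C := C + C) (D := c + C) (by fun_prop) hf0
      (fun x ↦ by linarith [le_of_abs_le (hC x)]) measurable_const (fun _ ↦ hcC) (fun _ ↦ le_rfl)
      (by simpa using hshift)
    exact ⟨c, hae.mono fun x hx ↦ add_right_cancel hx⟩
  · exact ae_const_of_ae_eq_gaussian_convolution hv hf_meas hC h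
end

section
/- For every R > 0 there exist p > 1 and C > 0 such that for every v ∈ [0, R²], ∫_ℝ ∫_ℝ ( exp(x) · exp(-(t-x)²/2 + t²/2) )^p dγ(t) dμ_v(x) ≤ C, where γ is the standard Gaussian measure on ℝ (mean 0, variance 1) and μ_v is the Gaussian measure on ℝ with mean -v/2 and variance v. -/
open MeasureTheory ProbabilityTheory
open scoped ENNReal

/-- The moment generating function of the standard Gaussian, as a lower Lebesgue integral. -/
lemma lintegral_exp_mul_gaussianReal_zero_one (s : ℝ) :
    ∫⁻ t, ENNReal.ofReal (Real.exp (s * t)) ∂(gaussianReal 0 1)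
      = ENNReal.ofReal (Real.exp (s ^ 2 / 2)) := by
  rw [← ofReal_integral_eq_lintegral_ofReal (integrable_exp_mul_gaussianReal s)
    (.of_forall fun _ => (Real.exp_pos _).le)]
  have h := congrFun (mgf_id_gaussianReal (μ := 0) (v := 1)) s
  simp only [mgf, id_eq, NNReal.coe_one, zero_mul, one_mul, zero_add] at h
  rw [h]

/-- `exp (c g²)` is integrable against the standard Gaussian when `c < 1 / 2`. -/
lemma lintegral_exp_mul_sq_gaussianReal_lt_top {c : ℝ} (hc : c < 1 / 2) :
    ∫⁻ g, ENNReal.ofReal (Real.exp (c * g ^ 2)) ∂(gaussianReal 0 1) < ∞ := by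
  rw [gaussianReal_of_var_ne_zero 0 one_ne_zero,
    lintegral_withDensity_eq_lintegral_mul _ (measurable_gaussianPDF 0 1) (by fun_prop)]
  have hint : Integrable fun g : ℝ =>
      (√(2 * Real.pi))⁻¹ * Real.exp (-(1 / 2 - c) * g ^ 2) :=
    (integrable_exp_neg_mul_sq (sub_pos.2 hc)).const_mul _
  refine lt_of_eq_of_lt (lintegral_congr fun g => ?_) hint.lintegral_lt_top
  rw [Pi.mul_apply, gaussianPDF, ← ENNReal.ofReal_mul (gaussianPDFReal_nonneg _ _ _),
    gaussianPDFReal, mul_assoc, ← Real.exp_add]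
  congr 3
  · simp
  · push_cast
    ring

/-- The `L^p` integral of the density over the fibre variable `t`. -/
lemma lintegral_maharam_density_rpow (p x : ℝ) :
    ∫⁻ t, ENNReal.ofReal ((Real.exp x * Real.exp (-(t - x) ^ 2 / 2 + t ^ 2 / 2)) ^ p)
        ∂(gaussianReal 0 1)
      = ENNReal.ofReal (Real.exp (p * x + p * (p - 1) / 2 * x ^ 2)) := by
  have h (t : ℝ) : ENNReal.ofReal
      ((Real.exp x * Real.exp (-(t - x) ^ 2 / 2 + t ^ 2 / 2)) ^ p)
      = ENNReal.ofReal (Real.exp (p * x - p * x ^ 2 / 2))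
        * ENNReal.ofReal (Real.exp (p * x * t)) := by
    rw [← ENNReal.ofReal_mul (Real.exp_pos _).le, ← Real.exp_add, ← Real.exp_add,
      ← Real.exp_mul]
    congr 2
    ring
  simp_rw [h]
  rw [lintegral_const_mul _ (by fun_prop), lintegral_exp_mul_gaussianReal_zero_one,
    ← ENNReal.ofReal_mul (Real.exp_pos _).le, ← Real.exp_add]
  congr 2
  ring

/-- A Gaussian of variance `v` is an affine image of the standard Gaussian. -/
lemma gaussianReal_eq_map_zero_one (m : ℝ) {v : ℝ} (hv : 0 ≤ v) :
    gaussianReal m v.toNNReal = (gaussianReal 0 1).map fun g => m + √v * g := by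
  have h : (fun g : ℝ => m + √v * g) = (fun y => m + y) ∘ fun g => √v * g := rfl
  rw [h, ← Measure.map_map (by fun_prop) (by fun_prop), gaussianReal_map_const_mul,
    gaussianReal_map_const_add]
  congr 1
  · simp
  · ext
    simp [hv]

/-- **Lemma `Lp integrable`.** For every `R > 0` there are `p > 1` and `C > 0`
such that for every `v ∈ [0, R²]`,
`∫∫ (eˣ · exp(-(t-x)²/2 + t²/2))^p dγ(t) dμ_v(x) ≤ C`,
where `γ` is the standard Gaussian and `μ_v` the Gaussian of mean `-v/2` and variance `v`. -/
theorem maharam_density_uniformly_Lp (R : ℝ) (hR : 0 < R) :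
    ∃ p : ℝ, 1 < p ∧ ∃ C : ℝ, 0 < C ∧ ∀ v : ℝ, 0 ≤ v → v ≤ R ^ 2 →
      ∫⁻ x, (∫⁻ t, ENNReal.ofReal
            ((Real.exp x * Real.exp (-(t - x) ^ 2 / 2 + t ^ 2 / 2)) ^ p)
          ∂(gaussianReal 0 1)) ∂(gaussianReal (-v / 2) v.toNNReal)
        ≤ ENNReal.ofReal C := by
  obtain ⟨p, hp1, hp2, hpR⟩ : ∃ p : ℝ, 1 < p ∧ p ≤ 2 ∧ (p - 1) * (8 * R ^ 2) ≤ 1 := by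
    refine ⟨1 + 1 / (1 + 8 * R ^ 2), ?_, ?_, ?_⟩
    · have : 0 < 1 / (1 + 8 * R ^ 2) := by positivity
      linarith
    · have : 1 / (1 + 8 * R ^ 2) ≤ 1 := by
        rw [div_le_one (by positivity)]
        nlinarith
      linarith
    · rw [add_sub_cancel_left, one_div_mul_eq_div, div_le_one (by positivity)]
      linarith
  set a : ℝ := p * (p - 1) / 2 with ha
  have ha0 : 0 ≤ a := by
    have : 0 ≤ p - 1 := by linarith
    positivity
  have haR : a * R ^ 2 ≤ 1 / 8 := by nlinarith [sq_nonneg R]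
  set I := ∫⁻ g, ENNReal.ofReal (Real.exp (3 / 8 * g ^ 2)) ∂(gaussianReal 0 1)
  have hItop : I < ∞ := lintegral_exp_mul_sq_gaussianReal_lt_top (by norm_num)
  set K : ℝ := R ^ 2 / 16 + 8 * R ^ 2 with hK
  refine ⟨p, hp1, Real.exp K * I.toReal + 1, by positivity, fun v hv hvR => ?_⟩
  simp_rw [lintegral_maharam_density_rpow, ← ha]
  rw [gaussianReal_eq_map_zero_one _ hv, lintegral_map (by fun_prop) (by fun_prop)]
  have hav : a * v ≤ 1 / 8 := (mul_le_mul_of_nonneg_left hvR ha0).trans haR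
  have hexp (g : ℝ) : p * (-v / 2 + √v * g) + a * (-v / 2 + √v * g) ^ 2
      ≤ K + 3 / 8 * g ^ 2 := by
    have hs : √v ^ 2 = v := Real.sq_sqrt hv
    have hlin : p * (√v * g) ≤ 8 * v + g ^ 2 / 8 := by
      have hpv : p ^ 2 * v ≤ 4 * v := by
        have : p ^ 2 ≤ 4 := by nlinarith
        gcongr
      nlinarith [sq_nonneg (4 * (p * √v) - g)]
    have hsq : (-v / 2 + √v * g) ^ 2 ≤ v ^ 2 / 2 + 2 * v * g ^ 2 := by
      nlinarith [sq_nonneg (-v / 2 - √v * g)]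
    have hquad := mul_le_mul_of_nonneg_left hsq ha0
    nlinarith [mul_le_mul_of_nonneg_right hav (sq_nonneg g),
      mul_le_mul_of_nonneg_right hav hv, mul_nonneg (zero_le_one.trans hp1.le) hv]
  calc ∫⁻ g, ENNReal.ofReal
          (Real.exp (p * (-v / 2 + √v * g) + a * (-v / 2 + √v * g) ^ 2)) ∂(gaussianReal 0 1)
      ≤ ∫⁻ g, ENNReal.ofReal (Real.exp K) * ENNReal.ofReal (Real.exp (3 / 8 * g ^ 2))
          ∂(gaussianReal 0 1) := by
        refine lintegral_mono fun g => ?_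
        rw [← ENNReal.ofReal_mul (Real.exp_pos _).le, ← Real.exp_add]
        exact ENNReal.ofReal_le_ofReal (Real.exp_le_exp.2 (hexp g))
    _ = ENNReal.ofReal (Real.exp K * I.toReal) := by
        rw [lintegral_const_mul _ (by fun_prop), ENNReal.ofReal_mul (Real.exp_pos _).le,
          ENNReal.ofReal_toReal hItop.ne]
    _ ≤ ENNReal.ofReal (Real.exp K * I.toReal + 1) :=
        ENNReal.ofReal_le_ofReal (by linarith)
end

section
/- Let Γ be a countable group with a nonsingular action σ on a probability space (X,μ) and let N ⊴ Γ be a normal subgroup. Assume: (a) the restriction of σ to N is ergodic, i.e. every N-invariant measurable subset of X is null or conull; (b) σ is amenable, in the sense that there exists a positive unital linear map E : L^∞(Γ × X) → L^∞(X) (Γ carrying counting measure) that is Γ-equivariant for the diagonal action: E(g·f) = g·E(f) for all g ∈ Γ, where (g·f)(h,x) = f(g⁻¹h, g⁻¹·x) and (g·F)(x) = F(g⁻¹·x). Then the quotient group Γ/N is amenable: there exists a positive unital linear functional m on ℓ^∞(Γ/N;ℝ) that is invariant under left translations by Γ/N. -/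
open MeasureTheory
open scoped ENNReal

/-- For a nonsingular action of a countable group that is ergodic in the sense that every strictly
invariant set is null or conull, a measurable function that is almost everywhere invariant is
almost everywhere constant. -/
theorem exists_ae_eq_const_of_ae_invariant
    {Γ : Type*} [Group Γ] [Countable Γ] {X : Type*} [MeasurableSpace X] {μ : Measure X}
    {a : Γ → X → X} (ha_meas : ∀ g, Measurable (a g))
    (ha_one : ∀ x, a 1 x = x) (ha_mul : ∀ g h x, a (g * h) x = a g (a h x))
    {N : Subgroup Γ}
    (hErg : ∀ S : Set X, MeasurableSet S → (∀ n ∈ N, a n ⁻¹' S = S) → μ S = 0 ∨ μ Sᶜ = 0)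
    {F : X → ℝ} (hF : Measurable F) (hinv : ∀ n ∈ N, (fun x => F (a n x)) =ᵐ[μ] F) :
    ∃ c : ℝ, F =ᵐ[μ] fun _ => c := by
  refine Filter.exists_eventuallyEq_const_of_forall_separating MeasurableSet fun U hU => ?_
  have hall : ∀ᵐ x ∂μ, ∀ n : N, F (a n x) = F x := ae_all_iff.2 fun n => hinv n n.2
  set S : Set X := ⋂ n : N, a n ⁻¹' (F ⁻¹' U) with hS
  have hmem : ∀ x, x ∈ S ↔ ∀ n : N, F (a n x) ∈ U := fun x => by simp [hS]
  have hSm : MeasurableSet S := MeasurableSet.iInter fun n => ha_meas n (hF hU)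
  have hSinv : ∀ n ∈ N, a n ⁻¹' S = S := by
    intro k hk
    ext x
    rw [Set.mem_preimage, hmem, hmem]
    constructor
    · intro h n
      have := h (n * ⟨k, hk⟩⁻¹)
      rw [← ha_mul] at this
      simpa using this
    · intro h n
      rw [← ha_mul]
      exact h (n * ⟨k, hk⟩)
  rcases hErg S hSm hSinv with h | h
  · right
    filter_upwards [measure_eq_zero_iff_ae_notMem.1 h, hall] with x hx hx' hU
    exact hx ((hmem x).2 fun n => by rwa [hx' n])
  · left
    filter_upwards [measure_eq_zero_iff_ae_notMem.1 h] with x hx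
    have := (hmem x).1 (not_not.1 hx) 1
    simpa [ha_one] using this

/-- The diagonal translation of `Γ × X` by a nonsingular action preserves null sets. -/
theorem quasiMeasurePreserving_diagonal
    {Γ : Type*} [Group Γ] [Countable Γ] [MeasurableSpace Γ] [DiscreteMeasurableSpace Γ]
    {X : Type*} [MeasurableSpace X] {μ : Measure X} [SFinite μ] {φ : X → X}
    (hφ : Measure.QuasiMeasurePreserving φ μ μ) (g : Γ) :
    Measure.QuasiMeasurePreserving (fun q : Γ × X => (g * q.1, φ q.2))
      ((Measure.count : Measure Γ).prod μ) ((Measure.count : Measure Γ).prod μ) := by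
  have hg : Measure.QuasiMeasurePreserving (fun h : Γ => g * h) Measure.count Measure.count :=
    ⟨Measurable.of_discrete, fun s hs => by
      rw [Measure.count_eq_zero_iff] at hs
      simp [hs]⟩
  exact QuasiMeasurePreserving.prodMap hg hφ

/-- The pullback of a bounded function along `Γ × X → Γ → Q` is essentially bounded. -/
theorem memLp_top_pullback {Γ : Type*} [MeasurableSpace Γ] [DiscreteMeasurableSpace Γ]
    {X : Type*} [MeasurableSpace X] {Q : Type*} (p : Γ → Q) (ν : Measure (Γ × X))
    (f : lp (fun _ : Q => ℝ) ∞) : MemLp (fun q : Γ × X => f (p q.1)) ⊤ ν :=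
  memLp_top_of_bound
    ((Measurable.of_discrete (f := fun g => f (p g))).comp measurable_fst).aestronglyMeasurable
    ‖f‖ (Filter.Eventually.of_forall fun _ => lp.norm_apply_le_norm ENNReal.top_ne_zero f _)

/-- The pullback of a bounded function along `Γ × X → Γ → Q`, as an essentially bounded function. -/
noncomputable def lpPullback {Γ : Type*} [MeasurableSpace Γ] [DiscreteMeasurableSpace Γ]
    {X : Type*} [MeasurableSpace X] {Q : Type*} (p : Γ → Q) (ν : Measure (Γ × X)) :
    lp (fun _ : Q => ℝ) ∞ →ₗ[ℝ] Lp ℝ ⊤ ν where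
  toFun f := (memLp_top_pullback p ν f).toLp
  map_add' _ _ := rfl
  map_smul' _ _ := rfl

theorem coeFn_lpPullback {Γ : Type*} [MeasurableSpace Γ] [DiscreteMeasurableSpace Γ]
    {X : Type*} [MeasurableSpace X] {Q : Type*} (p : Γ → Q) (ν : Measure (Γ × X))
    (f : lp (fun _ : Q => ℝ) ∞) : lpPullback p ν f =ᵐ[ν] fun q => f (p q.1) :=
  MemLp.coeFn_toLp (memLp_top_pullback p ν f)

/-- **Lemma `property amenability`.** Let `Γ` be a countable group with a
nonsingular action on a probability space `(X,μ)` and let `N ⊴ Γ`. If the restriction of the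
action to `N` is ergodic and the action is amenable—there is a positive unital linear
`Γ`-equivariant map `E : L^∞(Γ × X) → L^∞(X)`—then `Γ/N` is amenable: there is a positive
unital linear functional on `ℓ^∞(Γ/N;ℝ)` invariant under left translations. -/
theorem quotient_amenable_of_amenable_action
    {Γ : Type*} [Group Γ] [Countable Γ] [MeasurableSpace Γ] [DiscreteMeasurableSpace Γ]
    {X : Type*} [MeasurableSpace X] (μ : Measure X) [IsProbabilityMeasure μ]
    (a : Γ → X → X) (ha_meas : ∀ g, Measurable (a g))
    (ha_one : ∀ x, a 1 x = x) (ha_mul : ∀ g h x, a (g * h) x = a g (a h x))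
    (ha_ns : ∀ g, μ.map (a g) ≪ μ ∧ μ ≪ μ.map (a g))
    (N : Subgroup Γ) [N.Normal]
    -- (a) the restriction of the action to `N` is ergodic
    (hErg : ∀ S : Set X, MeasurableSet S → (∀ n ∈ N, a n ⁻¹' S = S) → μ S = 0 ∨ μ Sᶜ = 0)
    -- (b) the action is amenable: a `Γ`-equivariant positive unital conditional expectation
    (E : Lp ℝ ⊤ ((Measure.count : Measure Γ).prod μ) →ₗ[ℝ] Lp ℝ ⊤ μ)
    (hE_pos : ∀ f : Lp ℝ ⊤ ((Measure.count : Measure Γ).prod μ), (∀ᵐ q ∂((Measure.count : Measure Γ).prod μ), 0 ≤ f q) →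
      ∀ᵐ x ∂μ, 0 ≤ E f x)
    (hE_unital : ∀ f : Lp ℝ ⊤ ((Measure.count : Measure Γ).prod μ), ((f : Γ × X → ℝ) =ᵐ[(Measure.count : Measure Γ).prod μ] fun _ => 1) →
      (E f : X → ℝ) =ᵐ[μ] fun _ => 1)
    (hE_equiv : ∀ (g : Γ) (f f' : Lp ℝ ⊤ ((Measure.count : Measure Γ).prod μ)),
      ((f' : Γ × X → ℝ) =ᵐ[(Measure.count : Measure Γ).prod μ]
          fun q => f (g⁻¹ * q.1, a g⁻¹ q.2)) →
      (E f' : X → ℝ) =ᵐ[μ] fun x => (E f) (a g⁻¹ x)) :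
    ∃ m : lp (fun _ : Γ ⧸ N => ℝ) ∞ →ₗ[ℝ] ℝ,
      (∀ f, (∀ i, 0 ≤ f i) → 0 ≤ m f) ∧
      (∀ f, (∀ i, f i = (1 : ℝ)) → m f = 1) ∧
      (∀ (q : Γ ⧸ N) (f f' : lp (fun _ : Γ ⧸ N => ℝ) ∞),
        (∀ i, f' i = f (q⁻¹ * i)) → m f' = m f) := by
  have hqmp : ∀ g, Measure.QuasiMeasurePreserving (a g) μ μ := fun g => ⟨ha_meas g, (ha_ns g).1⟩
  let P := lpPullback (fun g : Γ => (g : Γ ⧸ N)) ((Measure.count : Measure Γ).prod μ)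
  have htrans : ∀ (g : Γ) (f f' : lp (fun _ : Γ ⧸ N => ℝ) ∞),
      (∀ i, f' i = f ((g : Γ ⧸ N)⁻¹ * i)) →
      (E (P f') : X → ℝ) =ᵐ[μ] fun x => E (P f) (a g⁻¹ x) := by
    intro g f f' hff'
    refine hE_equiv g _ _ ?_
    have h := (quasiMeasurePreserving_diagonal (hqmp g⁻¹) g⁻¹).ae_eq_comp
      (coeFn_lpPullback (fun g : Γ => (g : Γ ⧸ N)) _ f)
    refine (coeFn_lpPullback _ _ f').trans (Filter.EventuallyEq.trans ?_ h.symm)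
    exact Filter.Eventually.of_forall fun q => by simp [hff']
  have hconst : ∀ f : lp (fun _ : Γ ⧸ N => ℝ) ∞, ∃ c : ℝ, (E (P f) : X → ℝ) =ᵐ[μ] fun _ => c := by
    intro f
    refine exists_ae_eq_const_of_ae_invariant ha_meas ha_one ha_mul hErg
      (Lp.stronglyMeasurable _).measurable fun n hn => ?_
    have hn1 : ((n⁻¹ : Γ) : Γ ⧸ N) = 1 := (QuotientGroup.eq_one_iff _).2 (N.inv_mem hn)
    have h := htrans n⁻¹ f f fun i => by rw [hn1]; simp
    simpa using h.symm
  have hint : ∀ f : Lp ℝ ⊤ μ, Integrable f μ := fun f => (Lp.memLp f).integrable le_top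
  refine ⟨{ toFun := fun f => ∫ x, E (P f) x ∂μ, map_add' := ?_, map_smul' := ?_ }, ?_, ?_, ?_⟩
  · intro f f'
    rw [map_add, map_add, ← integral_add (hint _) (hint _)]
    exact integral_congr_ae (Lp.coeFn_add _ _)
  · intro c f
    rw [map_smul, map_smul, RingHom.id_apply, smul_eq_mul, ← integral_const_mul]
    exact integral_congr_ae (Lp.coeFn_smul _ _)
  · intro f hf
    refine integral_nonneg_of_ae (hE_pos _ ?_)
    filter_upwards [coeFn_lpPullback (fun g : Γ => (g : Γ ⧸ N)) _ f] with q hq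
    rw [hq]
    exact hf _
  · intro f hf
    have h : (E (P f) : X → ℝ) =ᵐ[μ] fun _ => 1 := by
      refine hE_unital _ ((coeFn_lpPullback _ _ f).trans ?_)
      exact Filter.Eventually.of_forall fun q => hf _
    simpa using integral_congr_ae h
  · intro q f f' hff'
    obtain ⟨g, rfl⟩ := QuotientGroup.mk_surjective q
    obtain ⟨c, hc⟩ := hconst f
    exact integral_congr_ae
      ((htrans g f f' hff').trans (((hqmp g⁻¹).ae_eq_comp hc).trans hc.symm))
end

section
/- The measure ν is nonatomic (ν({t}) = 0 for every t ∈ [-1/2,1/2]) if and only if ∑_{n=1}^∞ (1-p_n) = +∞. -/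
open MeasureTheory Filter
open scoped ENNReal

/-- The integer `∑_{i < N} 3^(N-1-i) dᵢ` whose ternary digits are `d₀, …, d_{N-1}`. -/
def ternaryPrefix (d : ℕ → ℤ) : ℕ → ℤ
  | 0 => 0
  | N + 1 => 3 * ternaryPrefix d N + d N

/-- The coordinates of `x` with index at least `1` are the balanced ternary digits `d`. -/
def HasTernaryDigits (x : ℕ → ℝ) (d : ℕ → ℤ) : Prop :=
  ∀ n, |d n| ≤ 1 ∧ x (n + 1) = d n

theorem eq_of_ternaryPrefix_eq {d e : ℕ → ℤ} (hd : ∀ n, |d n| ≤ 1) (he : ∀ n, |e n| ≤ 1)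
    {N : ℕ} (h : ternaryPrefix d N = ternaryPrefix e N) : ∀ i < N, d i = e i := by
  induction N with
  | zero => simp
  | succ N ih =>
    simp only [ternaryPrefix] at h
    have h1 := abs_le.1 (hd N)
    have h2 := abs_le.1 (he N)
    intro i hi
    rcases Nat.lt_succ_iff_lt_or_eq.1 hi with hi | rfl
    · exact ih (by omega) i hi
    · omega

theorem sum_range_eq_ternaryPrefix (d : ℕ → ℤ) (N : ℕ) :
    ∑ i ∈ Finset.range N, ((3 : ℝ)⁻¹) ^ (i + 1) * d i = ternaryPrefix d N / 3 ^ N := by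
  induction N with
  | zero => simp [ternaryPrefix]
  | succ N ih =>
    rw [Finset.sum_range_succ, ih, ternaryPrefix]
    push_cast
    rw [inv_pow]
    field_simp
    ring

theorem hasSum_ternary_tail (N : ℕ) :
    HasSum (fun n : ℕ => ((3 : ℝ)⁻¹) ^ (n + N + 1)) (((3 : ℝ) ^ N)⁻¹ / 2) := by
  have h := (hasSum_geometric_of_lt_one (r := (3 : ℝ)⁻¹) (by norm_num) (by norm_num)).mul_left
    (((3 : ℝ)⁻¹) ^ (N + 1))
  have hsum : ((3 : ℝ)⁻¹) ^ (N + 1) * (1 - (3 : ℝ)⁻¹)⁻¹ = ((3 : ℝ) ^ N)⁻¹ / 2 := by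
    rw [pow_succ, inv_pow]
    norm_num
    ring
  rw [hsum] at h
  exact h.congr_fun fun n => by rw [← pow_add]; congr 1; omega

theorem HasTernaryDigits.norm_term_le {x : ℕ → ℝ} {d : ℕ → ℤ} (h : HasTernaryDigits x d)
    (n : ℕ) : ‖((3 : ℝ)⁻¹) ^ (n + 1) * x (n + 1)‖ ≤ ((3 : ℝ)⁻¹) ^ (n + 1) := by
  have hx : |x (n + 1)| ≤ 1 := by
    rw [(h n).2]
    exact_mod_cast (h n).1
  rw [norm_mul, Real.norm_eq_abs, Real.norm_eq_abs, abs_of_pos (by positivity)]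
  exact mul_le_of_le_one_right (by positivity) hx

theorem HasTernaryDigits.summable {x : ℕ → ℝ} {d : ℕ → ℤ} (h : HasTernaryDigits x d) :
    Summable fun n : ℕ => ((3 : ℝ)⁻¹) ^ (n + 1) * x (n + 1) :=
  Summable.of_norm_bounded (hasSum_ternary_tail 0).summable h.norm_term_le

theorem HasTernaryDigits.abs_sub_ternaryPrefix_le {x : ℕ → ℝ} {d : ℕ → ℤ}
    (h : HasTernaryDigits x d) (N : ℕ) :
    |3 ^ N * cantorCoord x - ternaryPrefix d N| ≤ 1 / 2 := by
  have htail := tsum_of_norm_bounded (hasSum_ternary_tail N) fun n => h.norm_term_le (n + N)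
  have hsum := h.summable.sum_add_tsum_nat_add N
  have hpre : ∑ i ∈ Finset.range N, ((3 : ℝ)⁻¹) ^ (i + 1) * x (i + 1)
      = ternaryPrefix d N / 3 ^ N := by
    simp_rw [fun n => (h n).2]
    exact sum_range_eq_ternaryPrefix d N
  rw [hpre] at hsum
  have h3 : (0 : ℝ) < 3 ^ N := by positivity
  have key : 3 ^ N * cantorCoord x - ternaryPrefix d N
      = 3 ^ N * ∑' n : ℕ, ((3 : ℝ)⁻¹) ^ (n + N + 1) * x (n + N + 1) := by
    rw [cantorCoord, ← hsum]
    field_simp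
    ring
  rw [key, abs_mul, abs_of_pos h3]
  calc (3 : ℝ) ^ N * _ ≤ 3 ^ N * (((3 : ℝ) ^ N)⁻¹ / 2) :=
        mul_le_mul_of_nonneg_left htail h3.le
    _ = 1 / 2 := by field_simp

theorem HasTernaryDigits.ternaryPrefix_eq {x : ℕ → ℝ} {d : ℕ → ℤ}
    (h : HasTernaryDigits x d) (N : ℕ) :
    ternaryPrefix d N = ⌊3 ^ N * cantorCoord x⌋ ∨
      ternaryPrefix d N = ⌊3 ^ N * cantorCoord x⌋ + 1 := by
  have h1 := abs_le.1 (h.abs_sub_ternaryPrefix_le N)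
  have h2 := Int.floor_le (3 ^ N * cantorCoord x)
  have h3 := Int.lt_floor_add_one (3 ^ N * cantorCoord x)
  generalize ⌊3 ^ N * cantorCoord x⌋ = k at *
  have h4 : k - 1 < ternaryPrefix d N := by
    have : (k : ℝ) - 1 < ternaryPrefix d N := by linarith
    exact_mod_cast this
  have h5 : ternaryPrefix d N < k + 2 := by
    have : (ternaryPrefix d N : ℝ) < k + 2 := by linarith
    exact_mod_cast this
  omega

theorem HasTernaryDigits.cantorCoord_mem_range_ratCast {x : ℕ → ℝ} {d : ℕ → ℤ}
    (h : HasTernaryDigits x d) {N : ℕ} (hN : ∀ n ≥ N, x (n + 1) = 0) :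
    cantorCoord x ∈ Set.range ((↑) : ℚ → ℝ) := by
  refine ⟨ternaryPrefix d N / 3 ^ N, ?_⟩
  rw [cantorCoord, tsum_eq_sum (s := Finset.range N)]
  · simp_rw [fun n => (h n).2]
    rw [sum_range_eq_ternaryPrefix]
    push_cast
    rfl
  · intro n hn
    rw [hN n (by simpa using hn), mul_zero]

theorem cantorFactor_singleton_le {p : ℕ → ℝ} {n : ℕ} (h0 : 0 ≤ p n) (h1 : p n ≤ 1) (a : ℝ) :
    cantorFactor p n {a} ≤ ENNReal.ofReal (Real.exp (-((1 - p n) / 2))) := by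
  have hexp := Real.add_one_le_exp (-((1 - p n) / 2))
  have hp : p n ≤ Real.exp (-((1 - p n) / 2)) := by linarith
  have hq : (1 - p n) / 2 ≤ Real.exp (-((1 - p n) / 2)) := by linarith
  by_cases ha : a = -1
  · subst ha
    norm_num [cantorFactor, Set.indicator]
    exact ENNReal.ofReal_le_ofReal hq
  by_cases hb : a = 0
  · subst hb
    norm_num [cantorFactor, Set.indicator]
    exact ENNReal.ofReal_le_ofReal hp
  by_cases hc : a = 1
  · subst hc
    norm_num [cantorFactor, Set.indicator]
    exact ENNReal.ofReal_le_ofReal hq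
  · simp [cantorFactor, Ne.symm ha, Ne.symm hb, Ne.symm hc]

namespace IsCantorProductMeasure

variable {p : ℕ → ℝ} {ζ : Measure (ℕ → ℝ)}

theorem measure_coord_mem (hζ : IsCantorProductMeasure p ζ) (n : ℕ) {B : Set ℝ}
    (hB : MeasurableSet B) : ζ {x | x (n + 1) ∈ B} = cantorFactor p (n + 1) B := by
  simpa using hζ.2 {n + 1} (by simp) (fun _ => B) fun _ => hB

theorem ae_hasTernaryDigits (hζ : IsCantorProductMeasure p ζ) :
    ∀ᵐ x ∂ζ, ∃ d, HasTernaryDigits x d := by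
  have h : ∀ n : ℕ, ∀ᵐ x ∂ζ, x (n + 1) ∈ ({-1, 0, 1} : Set ℝ) := by
    intro n
    have hB : MeasurableSet ({-1, 0, 1} : Set ℝ)ᶜ := (Set.toFinite _).measurableSet.compl
    rw [ae_iff]
    refine (hζ.measure_coord_mem n hB).trans ?_
    simp [cantorFactor]
  filter_upwards [ae_all_iff.2 h] with x hx
  have : ∀ n, ∃ k : ℤ, |k| ≤ 1 ∧ x (n + 1) = k := by
    intro n
    rcases hx n with h | h | h
    · exact ⟨-1, by simp, by simp [h]⟩
    · exact ⟨0, by simp, by simp [h]⟩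
    · exact ⟨1, by simp, by simpa using h⟩
  exact Classical.skolem.1 this

theorem aemeasurable_cantorCoord_s16 (hζ : IsCantorProductMeasure p ζ) :
    AEMeasurable cantorCoord ζ := by
  refine aemeasurable_of_tendsto_metrizable_ae atTop
    (f := fun N x => ∑ n ∈ Finset.range N, ((3 : ℝ)⁻¹) ^ (n + 1) * x (n + 1)) (fun N => ?_) ?_
  · exact Measurable.aemeasurable (by fun_prop)
  · filter_upwards [hζ.ae_hasTernaryDigits] with x ⟨d, hd⟩
    exact hd.summable.hasSum.tendsto_sum_nat

theorem ae_eventually_eq_zero (hζ : IsCantorProductMeasure p ζ)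
    (hp : ∀ n, 1 ≤ n → 0 ≤ p n ∧ p n ≤ 1) (hs : Summable fun n : ℕ => 1 - p (n + 1)) :
    ∀ᵐ x ∂ζ, ∀ᶠ n : ℕ in atTop, x (n + 1) = 0 := by
  have hmeas (n : ℕ) : ζ {x | x (n + 1) ∈ ({0} : Set ℝ)ᶜ} = ENNReal.ofReal (1 - p (n + 1)) := by
    have h1 := (hp (n + 1) (by omega)).2
    rw [hζ.measure_coord_mem n (measurableSet_singleton 0).compl]
    simp only [cantorFactor, Measure.coe_add, Measure.coe_smul, Pi.add_apply, Pi.smul_apply]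
    norm_num [Set.indicator]
    rw [← ENNReal.ofReal_add (by linarith) (by linarith), add_halves]
  have htsum : ∑' n : ℕ, ζ {x | x (n + 1) ∈ ({0} : Set ℝ)ᶜ} ≠ ∞ := by
    simp_rw [hmeas]
    exact hs.tsum_ofReal_ne_top
  filter_upwards [ae_eventually_notMem htsum] with x hx
  filter_upwards [hx] with n hn
  simpa using hn

theorem measure_ternaryPrefix_eq_le (hζ : IsCantorProductMeasure p ζ)
    (hp : ∀ n, 1 ≤ n → 0 ≤ p n ∧ p n ≤ 1) (N : ℕ) (k : ℤ) :
    ζ {x | ∃ d, HasTernaryDigits x d ∧ ternaryPrefix d N = k} ≤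
      ENNReal.ofReal (Real.exp (-((∑ i ∈ Finset.range N, (1 - p (i + 1))) / 2))) := by
  rcases Set.eq_empty_or_nonempty {x | ∃ d, HasTernaryDigits x d ∧ ternaryPrefix d N = k}
    with hempty | ⟨y, e, hy, he⟩
  · simp [hempty]
  have hsub : {x | ∃ d, HasTernaryDigits x d ∧ ternaryPrefix d N = k} ⊆
      {x | ∀ n ∈ (Finset.range N).image (· + 1), x n ∈ ({y n} : Set ℝ)} := by
    rintro x ⟨d, hx, hd⟩ n hn
    obtain ⟨i, hi, rfl⟩ := Finset.mem_image.1 hn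
    have := eq_of_ternaryPrefix_eq (fun n => (hx n).1) (fun n => (hy n).1) (hd.trans he.symm) i
      (Finset.mem_range.1 hi)
    simp [(hx i).2, (hy i).2, this]
  refine (measure_mono hsub).trans ?_
  rw [hζ.2 _ (by simp) (fun n => {y n}) fun n => measurableSet_singleton _,
    Finset.prod_image (by simp), Finset.sum_div, ← Finset.sum_neg_distrib, Real.exp_sum,
    ENNReal.ofReal_prod_of_nonneg fun _ _ => (Real.exp_pos _).le]
  refine Finset.prod_le_prod' fun i _ => ?_
  have := hp (i + 1) (by omega)
  exact cantorFactor_singleton_le this.1 this.2 _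

theorem measure_cantorCoord_eq_le (hζ : IsCantorProductMeasure p ζ)
    (hp : ∀ n, 1 ≤ n → 0 ≤ p n ∧ p n ≤ 1) (N : ℕ) (t : ℝ) :
    ζ (cantorCoord ⁻¹' {t}) ≤
      2 * ENNReal.ofReal (Real.exp (-((∑ i ∈ Finset.range N, (1 - p (i + 1))) / 2))) := by
  let A (k : ℤ) : Set (ℕ → ℝ) := {x | ∃ d, HasTernaryDigits x d ∧ ternaryPrefix d N = k}
  have hle : cantorCoord ⁻¹' {t} ≤ᵐ[ζ] (A ⌊3 ^ N * t⌋ ∪ A (⌊3 ^ N * t⌋ + 1) : Set (ℕ → ℝ)) := by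
    filter_upwards [hζ.ae_hasTernaryDigits] with x ⟨d, hd⟩ hx
    obtain rfl : cantorCoord x = t := hx
    exact (hd.ternaryPrefix_eq N).imp (fun h => ⟨d, hd, h⟩) fun h => ⟨d, hd, h⟩
  calc ζ (cantorCoord ⁻¹' {t}) ≤ ζ (A ⌊3 ^ N * t⌋ ∪ A (⌊3 ^ N * t⌋ + 1)) := measure_mono_ae hle
    _ ≤ ζ (A ⌊3 ^ N * t⌋) + ζ (A (⌊3 ^ N * t⌋ + 1)) := measure_union_le _ _
    _ ≤ _ := by
      rw [two_mul]
      exact add_le_add (hζ.measure_ternaryPrefix_eq_le hp N _)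
        (hζ.measure_ternaryPrefix_eq_le hp N _)

end IsCantorProductMeasure

/-- The measure `ν` is nonatomic if and only if `∑_{n≥1} (1-pₙ) = +∞`. -/
theorem cantor_measure_nonatomic_iff
    (p : ℕ → ℝ) (hp : ∀ n, 1 ≤ n → 0 ≤ p n ∧ p n ≤ 1)
    (ζ : Measure (ℕ → ℝ)) (hζ : IsCantorProductMeasure p ζ)
    (ν : Measure ℝ) (hν : ν = ζ.map cantorCoord) :
    (∀ t : ℝ, ν {t} = 0) ↔ ¬ Summable (fun n : ℕ => 1 - p (n + 1)) := by
  subst hν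
  have hmeas := hζ.aemeasurable_cantorCoord_s16
  constructor
  · intro hna hs
    have : IsProbabilityMeasure ζ := hζ.1
    have hcount : (Set.range ((↑) : ℚ → ℝ)).Countable := Set.countable_range _
    have hnull : ∀ᵐ x ∂ζ, cantorCoord x ∉ Set.range ((↑) : ℚ → ℝ) := by
      refine ae_of_ae_map hmeas (p := fun t => t ∉ Set.range ((↑) : ℚ → ℝ)) ?_
      rw [ae_iff]
      simpa only [not_not, Set.ofPred_mem_eq] using
        (measure_null_iff_singleton hcount).2 fun t _ => hna t
    obtain ⟨x, hx, ⟨d, hd⟩, hev⟩ :=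
      (hnull.and (hζ.ae_hasTernaryDigits.and (hζ.ae_eventually_eq_zero hp hs))).exists
    obtain ⟨N, hN⟩ := eventually_atTop.1 hev
    exact hx (hd.cantorCoord_mem_range_ratCast hN)
  · intro hs t
    have hsum := (not_summable_iff_tendsto_nat_atTop_of_nonneg fun n => by
      linarith [(hp (n + 1) (by omega)).2]).1 hs
    have hlim : Tendsto (fun N => 2 * ENNReal.ofReal
        (Real.exp (-((∑ i ∈ Finset.range N, (1 - p (i + 1))) / 2)))) atTop (nhds 0) := by
      have h := ENNReal.tendsto_ofReal (Real.tendsto_exp_neg_atTop_nhds_zero.comp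
        (hsum.atTop_div_const (by norm_num : (0 : ℝ) < 2)))
      simpa using ENNReal.Tendsto.const_mul h (Or.inr ENNReal.ofNat_ne_top)
    rw [Measure.map_apply_of_aemeasurable hmeas (measurableSet_singleton t)]
    exact le_antisymm (ge_of_tendsto' hlim fun N => hζ.measure_cantorCoord_eq_le hp N t) bot_le
end
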